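/- arXiv:2502.19036 — 5 statements merged into one kernel-verified Lean document; each statement's English description precedes it below -/
import Mathlib

section
/- Let c ≥ 4/3, let Λ be a lattice of rank n, and suppose (b₁,…,bₙ) is a c-reduced basis for Λ. Then for all i with 0 < i ≤ n we have c^{1−n}·q(b_i) ≤ λ_i(Λ) ≤ c^{i−1}·q(b_i). -/
open scoped RealInnerProductSpace

open InnerProductSpace in
/-- A family satisfying the Gram–Schmidt recursion is the Gram–Schmidt family. -/
theorem eq_gramSchmidt_of_recursion {E : Type*} [NormedAddCommGroup E] [InnerProductSpace ℝ E]
    {n : ℕ} {b bs : Fin n → E}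
    (hbs : ∀ i : Fin n, bs i = b i -
      ∑ j ∈ Finset.Iio i, (⟪b i, bs j⟫ / ⟪bs j, bs j⟫) • bs j) (i : Fin n) :
    bs i = gramSchmidt ℝ b i := by
  induction i using WellFoundedLT.induction with
  | ind i ih =>
    rw [hbs, gramSchmidt_def]
    congr 1
    refine Finset.sum_congr rfl fun j hj => ?_
    rw [Finset.mem_Iio] at hj
    rw [ih j hj, Submodule.starProjection_singleton, real_inner_comm, real_inner_self_eq_norm_sq]
    rfl

/-- The square norm of a sum `v + ∑ j ∈ s, a j • w j` of pairwise orthogonal terms. -/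
theorem inner_self_add_sum_smul_of_orthogonal {E ι : Type*} [NormedAddCommGroup E]
    [InnerProductSpace ℝ E] {w : ι → E} (hw : Pairwise fun i j => ⟪w i, w j⟫ = 0)
    (s : Finset ι) (a : ι → ℝ) (v : E) (hv : ∀ j ∈ s, ⟪v, w j⟫ = 0) :
    ⟪v + ∑ j ∈ s, a j • w j, v + ∑ j ∈ s, a j • w j⟫ =
      ⟪v, v⟫ + ∑ j ∈ s, a j ^ 2 * ⟪w j, w j⟫ := by
  classical
  have hvs : ⟪v, ∑ j ∈ s, a j • w j⟫ = 0 := by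
    rw [inner_sum]
    exact Finset.sum_eq_zero fun j hj => by rw [inner_smul_right, hv j hj, mul_zero]
  rw [real_inner_add_add_self, hvs, inner_sum, mul_zero, add_zero]
  congr 1
  refine Finset.sum_congr rfl fun j hj => ?_
  rw [sum_inner, Finset.sum_eq_single_of_mem j hj]
  · rw [inner_smul_left, inner_smul_right]
    simp only [conj_trivial]
    ring
  · intro k _ hk
    rw [inner_smul_left, inner_smul_right, hw hk, mul_zero, mul_zero]

theorem one_add_quarter_geom_sum_le {c : ℝ} (hc : 4 / 3 ≤ c) (m : ℕ) :
    1 + 1 / 4 * ∑ k ∈ Finset.range m, c ^ (m - k) ≤ c ^ m := by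
  induction m with
  | zero => simp
  | succ m ih =>
    have hsum : ∑ k ∈ Finset.range (m + 1), c ^ (m + 1 - k) =
        c ^ (m + 1) + ∑ k ∈ Finset.range m, c ^ (m - k) := by
      rw [Finset.sum_range_succ', add_comm]
      congr 1
      exact Finset.sum_congr rfl fun k _ => by rw [Nat.add_sub_add_right]
    rw [hsum, pow_succ]
    have : 0 < c ^ m := by positivity
    nlinarith

/-- The Lovász condition, iterated. -/
theorem le_pow_mul_of_lovasz {n : ℕ} {c : ℝ} (hc : 0 ≤ c) {Q : Fin n → ℝ}
    (hQ : ∀ k : ℕ, ∀ hk : k + 1 < n, Q ⟨k, Nat.lt_of_succ_lt hk⟩ ≤ c * Q ⟨k + 1, hk⟩)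
    {j i : Fin n} (hji : j ≤ i) : Q j ≤ c ^ ((i : ℕ) - j) * Q i := by
  obtain ⟨j, hj⟩ := j
  obtain ⟨i, hi⟩ := i
  rw [Fin.mk_le_mk] at hji
  induction i, hji using Nat.le_induction with
  | base => simp
  | succ i hji ih =>
    refine (ih (Nat.lt_of_succ_lt hi)).trans ?_
    have := mul_le_mul_of_nonneg_left (hQ i hi) (pow_nonneg hc (i - j))
    simp only [Nat.succ_sub hji, pow_succ, mul_assoc] at this ⊢
    exact this

/-- The square norm of a member of a `c`-reduced basis is bounded by that of the corresponding
Gram–Schmidt vector. -/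
theorem inner_self_le_pow_mul_of_reduced {E : Type*} [NormedAddCommGroup E]
    [InnerProductSpace ℝ E] {n : ℕ} {b bs : Fin n → E}
    (hbs : ∀ i : Fin n, bs i = b i -
      ∑ j ∈ Finset.Iio i, (⟪b i, bs j⟫ / ⟪bs j, bs j⟫) • bs j)
    (horth : Pairwise fun i j => ⟪bs i, bs j⟫ = 0) {c : ℝ} (hc : 4 / 3 ≤ c)
    (hred : ∀ i j : Fin n, j < i → |⟪b i, bs j⟫ / ⟪bs j, bs j⟫| ≤ 1 / 2)
    (hle : ∀ j i : Fin n, j ≤ i → ⟪bs j, bs j⟫ ≤ c ^ ((i : ℕ) - j) * ⟪bs i, bs i⟫)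
    (i : Fin n) : ⟪b i, b i⟫ ≤ c ^ (i : ℕ) * ⟪bs i, bs i⟫ := by
  have hexp : b i = bs i + ∑ j ∈ Finset.Iio i, (⟪b i, bs j⟫ / ⟪bs j, bs j⟫) • bs j :=
    sub_eq_iff_eq_add.mp (hbs i).symm
  have hq := inner_self_add_sum_smul_of_orthogonal horth (Finset.Iio i)
    (fun j => ⟪b i, bs j⟫ / ⟪bs j, bs j⟫) (bs i)
    fun j hj => horth (Finset.mem_Iio.mp hj).ne'
  rw [← hexp] at hq
  have hsum : ∑ j ∈ Finset.Iio i, c ^ ((i : ℕ) - j) =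
      ∑ k ∈ Finset.range i, c ^ ((i : ℕ) - k) := by
    rw [← Nat.Iio_eq_range, ← Fin.map_valEmbedding_Iio, Finset.sum_map]
    rfl
  calc ⟪b i, b i⟫
      = ⟪bs i, bs i⟫ +
          ∑ j ∈ Finset.Iio i, (⟪b i, bs j⟫ / ⟪bs j, bs j⟫) ^ 2 * ⟪bs j, bs j⟫ := hq
    _ ≤ ⟪bs i, bs i⟫ +
          ∑ j ∈ Finset.Iio i, 1 / 4 * (c ^ ((i : ℕ) - j) * ⟪bs i, bs i⟫) := by
        gcongr with j hj
        · exact real_inner_self_nonneg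
        · have h := sq_le_sq' (abs_le.mp (hred i j (Finset.mem_Iio.mp hj))).1
            (abs_le.mp (hred i j (Finset.mem_Iio.mp hj))).2
          norm_num at h ⊢
          exact h
        · exact hle j i (Finset.mem_Iio.mp hj).le
    _ = (1 + 1 / 4 * ∑ k ∈ Finset.range i, c ^ ((i : ℕ) - k)) * ⟪bs i, bs i⟫ := by
        rw [← Finset.mul_sum, ← Finset.sum_mul, hsum]
        ring
    _ ≤ c ^ (i : ℕ) * ⟪bs i, bs i⟫ :=
        mul_le_mul_of_nonneg_right (one_add_quarter_geom_sum_le hc i) real_inner_self_nonneg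

/-- An integer combination of the `b j` whose last nonzero coefficient is at `k` is at least as
long as the component `w` of `b k` orthogonal to the `b j` with `j < k`. -/
theorem inner_self_le_inner_self_sum {E : Type*} [NormedAddCommGroup E]
    [InnerProductSpace ℝ E] {n : ℕ} {b : Fin n → E} {w : E} {a : Fin n → ℤ} {k : Fin n}
    (hk : a k ≠ 0) (ha : ∀ j, k < j → a j = 0) (hlt : ∀ j, j < k → ⟪b j, w⟫ = 0)
    (hw : ⟪b k, w⟫ = ⟪w, w⟫) : ⟪w, w⟫ ≤ ⟪∑ j, a j • b j, ∑ j, a j • b j⟫ := by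
  set x := ∑ j, a j • b j with hx
  have hxw : ⟪x, w⟫ = a k * ⟪w, w⟫ := by
    rw [hx, sum_inner, Finset.sum_eq_single k]
    · rw [← Int.cast_smul_eq_zsmul ℝ, real_inner_smul_left, hw]
    · intro j _ hj
      rcases lt_or_gt_of_ne hj with h | h
      · rw [← Int.cast_smul_eq_zsmul ℝ, real_inner_smul_left, hlt j h, mul_zero]
      · rw [ha j h, zero_smul, inner_zero_left]
    · simp
  have hcs := real_inner_mul_inner_self_le x w
  rw [hxw] at hcs
  have hak : (1 : ℝ) ≤ (a k : ℝ) ^ 2 := by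
    exact_mod_cast (sq_pos_of_ne_zero hk : 0 < a k ^ 2)
  rcases (real_inner_self_nonneg (x := w)).eq_or_lt with h0 | h0
  · rw [← h0]
    exact real_inner_self_nonneg
  · refine le_of_mul_le_mul_right ?_ h0
    nlinarith [mul_pos h0 h0]

/-- Let `c ≥ 4/3` and let `(b₁,…,bₙ)` be a `c`-reduced basis of a lattice `Λ`
(the `ℤ`-span of the `ℝ`-linearly independent vectors `bᵢ` in a real inner product
space).  Here `bs` is the Gram–Schmidt basis of `b` and the `c`-reducedness
conditions are: the Gram–Schmidt coefficients satisfy `|μᵢⱼ| ≤ 1/2` for `j < i`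
and the Lovász condition `c·q(b*_{k+1}) ≥ q(b*_k)`.  Then for all `i`
(`1`-based index `i+1`), with `λᵢ(Λ)` the `i`-th successive minimum of `Λ`, we
have `c^{1−n}·q(bᵢ) ≤ λᵢ(Λ) ≤ c^{i−1}·q(bᵢ)`, where `q(x) = ⟪x,x⟫`. -/
theorem stmt_0 {E : Type*} [NormedAddCommGroup E] [InnerProductSpace ℝ E]
    (n : ℕ) (b : Fin n → E) (hb : LinearIndependent ℝ b)
    (bs : Fin n → E)
    (hbs : ∀ i : Fin n, bs i = b i -
      ∑ j ∈ Finset.Iio i, (⟪b i, bs j⟫ / ⟪bs j, bs j⟫) • bs j)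
    (c : ℝ) (hc : 4 / 3 ≤ c)
    (hred : ∀ i j : Fin n, j < i → |⟪b i, bs j⟫ / ⟪bs j, bs j⟫| ≤ 1 / 2)
    (hlovasz : ∀ k : ℕ, ∀ hk : k + 1 < n,
      ⟪bs ⟨k, Nat.lt_of_succ_lt hk⟩, bs ⟨k, Nat.lt_of_succ_lt hk⟩⟫ ≤
        c * ⟪bs ⟨k + 1, hk⟩, bs ⟨k + 1, hk⟩⟫)
    (i : Fin n) :
    c ^ ((1 : ℤ) - n) * ⟪b i, b i⟫ ≤
      sInf {r : ℝ | 0 ≤ r ∧ ((i : ℕ) + 1 : Cardinal) ≤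
        Module.rank ℤ (Submodule.span ℤ
          {x : E | x ∈ Submodule.span ℤ (Set.range b) ∧ ⟪x, x⟫ ≤ r})} ∧
    sInf {r : ℝ | 0 ≤ r ∧ ((i : ℕ) + 1 : Cardinal) ≤
        Module.rank ℤ (Submodule.span ℤ
          {x : E | x ∈ Submodule.span ℤ (Set.range b) ∧ ⟪x, x⟫ ≤ r})} ≤
      c ^ (i : ℕ) * ⟪b i, b i⟫ := by
  have hc1 : 1 ≤ c := by linarith
  have hc0 : 0 < c := by linarith
  have hgs := eq_gramSchmidt_of_recursion hbs
  have horth : Pairwise fun i j => ⟪bs i, bs j⟫ = 0 := fun i j hij => by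
    simpa only [hgs] using InnerProductSpace.gramSchmidt_orthogonal ℝ b hij
  have hlt : ∀ k j : Fin n, j < k → ⟪b j, bs k⟫ = 0 := fun k j hjk => by
    rw [hgs, real_inner_comm]
    exact InnerProductSpace.gramSchmidt_inv_triangular ℝ b hjk
  have hdiag : ∀ k : Fin n, ⟪b k, bs k⟫ = ⟪bs k, bs k⟫ := fun k => by
    have h : ⟪∑ j ∈ Finset.Iio k, (⟪b k, bs j⟫ / ⟪bs j, bs j⟫) • bs j, bs k⟫ = 0 := by
      rw [sum_inner]
      refine Finset.sum_eq_zero fun j hj => ?_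
      rw [real_inner_smul_left, horth (Finset.mem_Iio.mp hj).ne, mul_zero]
    have hk := congrArg (fun v => ⟪v, bs k⟫) (hbs k)
    simp only [inner_sub_left, h, sub_zero] at hk
    exact hk.symm
  have hle : ∀ j i : Fin n, j ≤ i → ⟪bs j, bs j⟫ ≤ c ^ ((i : ℕ) - j) * ⟪bs i, bs i⟫ :=
    fun j i hji => le_pow_mul_of_lovasz (Q := fun k => ⟪bs k, bs k⟫) hc0.le hlovasz hji
  have hb_le := inner_self_le_pow_mul_of_reduced hbs horth hc hred hle
  have hb_le' : ∀ j k : Fin n, j ≤ k → ⟪b j, b j⟫ ≤ c ^ (k : ℕ) * ⟪bs k, bs k⟫ :=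
    fun j k hjk => (hb_le j).trans <| by
      have h := mul_le_mul_of_nonneg_left (hle j k hjk) (pow_nonneg hc0.le (j : ℕ))
      rwa [← mul_assoc, ← pow_add, Nat.add_sub_of_le (Fin.le_def.mp hjk)] at h
  have hbs_le : ∀ k : Fin n, ⟪bs k, bs k⟫ ≤ ⟪b k, b k⟫ := fun k => by
    have h := inner_self_le_inner_self_sum (b := b) (w := bs k) (a := Pi.single k 1) (k := k)
      (by simp) (fun j hj => Pi.single_eq_of_ne hj.ne' 1) (hlt k) (hdiag k)
    have hsum : ∑ j, (Pi.single k 1 : Fin n → ℤ) j • b j = b k := by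
      rw [Finset.sum_eq_single k] <;> simp +contextual
    rwa [hsum] at h
  have hmem : c ^ (i : ℕ) * ⟪b i, b i⟫ ∈ {r : ℝ | 0 ≤ r ∧ ((i : ℕ) + 1 : Cardinal) ≤
      Module.rank ℤ (Submodule.span ℤ
        {x : E | x ∈ Submodule.span ℤ (Set.range b) ∧ ⟪x, x⟫ ≤ r})} := by
    refine ⟨mul_nonneg (pow_nonneg hc0.le _) real_inner_self_nonneg, ?_⟩
    have hbZ : LinearIndependent ℤ b := hb.restrict_scalars' ℤ
    have hbI : LinearIndependent ℤ fun j : Finset.Iic i => b j :=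
      hbZ.comp _ Subtype.val_injective
    have hsub : Submodule.span ℤ (Set.range fun j : Finset.Iic i => b j) ≤
        Submodule.span ℤ {x : E | x ∈ Submodule.span ℤ (Set.range b) ∧
          ⟪x, x⟫ ≤ c ^ (i : ℕ) * ⟪b i, b i⟫} := by
      refine Submodule.span_mono ?_
      rintro _ ⟨⟨j, hj⟩, rfl⟩
      refine ⟨Submodule.subset_span ⟨j, rfl⟩, (hb_le' j i (Finset.mem_Iic.mp hj)).trans ?_⟩
      exact mul_le_mul_of_nonneg_left (hbs_le i) (pow_nonneg hc0.le _)
    refine le_trans ?_ (Submodule.rank_mono hsub)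
    have hcard := Cardinal.mk_range_eq_of_injective hbI.injective
    rw [Cardinal.mk_coe_finset, Fin.card_Iic, Cardinal.lift_natCast, Cardinal.lift_uzero] at hcard
    rw [rank_span hbI, hcard]
    push_cast
    exact le_rfl
  refine ⟨le_csInf ⟨_, hmem⟩ ?_, csInf_le ⟨0, fun r hr => hr.1⟩ hmem⟩
  rintro r ⟨-, hr⟩
  obtain ⟨x, hxΛ, hxr, k, hik, hkx⟩ : ∃ x : E, x ∈ Submodule.span ℤ (Set.range b) ∧
      ⟪x, x⟫ ≤ r ∧ ∃ k : Fin n, i ≤ k ∧ ⟪bs k, bs k⟫ ≤ ⟪x, x⟫ := by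
    by_contra! hcon
    have hsub : Submodule.span ℤ {x : E | x ∈ Submodule.span ℤ (Set.range b) ∧ ⟪x, x⟫ ≤ r} ≤
        Submodule.span ℤ (Set.range fun j : Finset.Iio i => b j) := by
      refine Submodule.span_le.mpr ?_
      rintro x ⟨hxΛ, hxr⟩
      obtain ⟨a, rfl⟩ := (Submodule.mem_span_range_iff_exists_fun ℤ).mp hxΛ
      have ha : ∀ j, i ≤ j → a j = 0 := by
        by_contra! hne
        obtain ⟨j, hij, hj⟩ := hne
        obtain ⟨k, hk, hmax⟩ := (Finset.univ.filter fun j => i ≤ j ∧ a j ≠ 0).exists_max_image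
          id ⟨j, by simp [hij, hj]⟩
        simp only [Finset.mem_filter, Finset.mem_univ, true_and, id] at hk hmax
        refine (hcon _ hxΛ hxr k hk.1).not_ge
          (inner_self_le_inner_self_sum hk.2 (fun l hl => ?_) (hlt k) (hdiag k))
        by_contra h
        exact (hmax l ⟨hk.1.trans hl.le, h⟩).not_gt hl
      refine Submodule.sum_mem _ fun j _ => ?_
      rcases lt_or_ge j i with h | h
      · exact Submodule.smul_mem _ _ (Submodule.subset_span ⟨⟨j, Finset.mem_Iio.mpr h⟩, rfl⟩)
      · rw [ha j h, zero_smul]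
        exact Submodule.zero_mem _
    have hrange := Cardinal.mk_range_le_lift (f := fun j : Finset.Iio i => b j)
    rw [Cardinal.mk_coe_finset, Fin.card_Iio, Cardinal.lift_natCast, Cardinal.lift_uzero] at hrange
    have hcard := hr.trans ((Submodule.rank_mono hsub).trans ((rank_span_le _).trans hrange))
    have : (i : ℕ) + 1 ≤ i := by exact_mod_cast hcard
    omega
  have hkn : c ^ (k : ℕ) ≤ c ^ (n - 1) := pow_le_pow_right₀ hc1 (by omega)
  have hmain : ⟪b i, b i⟫ ≤ c ^ (n - 1) * r :=
    (hb_le' i k hik).trans <|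
      mul_le_mul hkn (hkx.trans hxr) real_inner_self_nonneg (pow_nonneg hc0.le _)
  have hexp : (1 : ℤ) - n = -((n - 1 : ℕ) : ℤ) := by
    have := i.pos
    omega
  rw [hexp, zpow_neg, zpow_natCast]
  exact (inv_mul_le_iff₀ (pow_pos hc0 _)).mpr hmain
end

section
/- Let v₁,…,v_s ∈ ℝⁿ be vectors whose ℤ-span Λ is a nonzero lattice, let B = max_i ‖v_i‖ and λ = √(λ₁(Λ)) (so λ² is the minimal square norm of a nonzero element of Λ), and let M = { (x₁,…,x_s) ∈ ℤ^s : Σ_i x_i v_i = 0 }. If M has rank k, then there exist linearly independent u₁,…,u_k ∈ M such that ‖u_i‖² ≤ (n+1)^{2n+1}·(B/λ)^{2n} for all i. -/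
open MeasureTheory Module in
/-- The volume packing bound for a separated finite set inside a ball. -/
theorem card_le_of_separated_of_dist_le {E : Type*} [NormedAddCommGroup E] [NormedSpace ℝ E]
    [FiniteDimensional ℝ E] (T : Finset E) (c : E) {r R : ℝ} (hr : 0 < r) (hR : 0 ≤ R)
    (hT : ∀ x ∈ T, dist x c ≤ R) (hsep : ∀ x ∈ T, ∀ y ∈ T, x ≠ y → r ≤ dist x y) :
    (T.card : ℝ) ≤ (2 * R / r + 1) ^ finrank ℝ E := by
  borelize E
  let μ : Measure E := Measure.addHaar
  have hδ : 0 < r / 2 := half_pos hr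
  have hρ : 0 < R + r / 2 := by positivity
  set A := ⋃ x ∈ T, Metric.ball x (r / 2) with hA
  have D : Set.Pairwise (T : Set E) (Function.onFun Disjoint fun x => Metric.ball x (r / 2)) := by
    intro x hx y hy hxy
    apply Metric.ball_disjoint_ball
    linarith [hsep x hx y hy hxy]
  have A_subset : A ⊆ Metric.ball c (R + r / 2) := by
    refine Set.iUnion₂_subset fun x hx => ?_
    apply Metric.ball_subset_ball'
    linarith [hT x hx]
  have I : (T.card : ENNReal) * ENNReal.ofReal ((r / 2) ^ finrank ℝ E) * μ (Metric.ball 0 1) ≤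
      ENNReal.ofReal ((R + r / 2) ^ finrank ℝ E) * μ (Metric.ball 0 1) :=
    calc
      (T.card : ENNReal) * ENNReal.ofReal ((r / 2) ^ finrank ℝ E) * μ (Metric.ball 0 1) = μ A := by
        rw [hA, measure_biUnion_finset D fun x _ => measurableSet_ball]
        simp only [μ.addHaar_ball_of_pos _ hδ, Finset.sum_const, nsmul_eq_mul, mul_assoc]
      _ ≤ μ (Metric.ball c (R + r / 2)) := measure_mono A_subset
      _ = _ := by simp only [μ.addHaar_ball_of_pos _ hρ]
  have J : (T.card : ENNReal) * ENNReal.ofReal ((r / 2) ^ finrank ℝ E) ≤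
      ENNReal.ofReal ((R + r / 2) ^ finrank ℝ E) :=
    (ENNReal.mul_le_mul_iff_left (Metric.measure_ball_pos _ _ zero_lt_one).ne'
      measure_ball_lt_top.ne).1 I
  rw [← ENNReal.ofReal_natCast, ← ENNReal.ofReal_mul (by positivity),
    ENNReal.ofReal_le_ofReal_iff (by positivity)] at J
  have h : 2 * R / r + 1 = (R + r / 2) / (r / 2) := by field_simp
  rw [h, div_pow, le_div_iff₀ (by positivity)]
  exact J

open Module in
/-- A pigeonhole (Siegel type) bound for a nontrivial integer relation among `finrank ℝ E + 1`
vectors of norm at most `B` whose nonzero integer combinations have norm at least `r`. -/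
theorem exists_int_relation_abs_le {E ι : Type*} [NormedAddCommGroup E] [NormedSpace ℝ E]
    [FiniteDimensional ℝ E] [Fintype ι] (v : ι → E) {r B : ℝ} (hr : 0 < r) (hrB : r ≤ B)
    (hv : ∀ i, ‖v i‖ ≤ B)
    (hmin : ∀ x : ι → ℤ, ∑ i, (x i : ℝ) • v i ≠ 0 → r ≤ ‖∑ i, (x i : ℝ) • v i‖)
    (S : Finset ι) (hS : S.card = finrank ℝ E + 1) :
    ∃ x : ι → ℤ, x ≠ 0 ∧ (∀ i ∉ S, x i = 0) ∧ ∑ i, (x i : ℝ) • v i = 0 ∧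
      ∀ i, |(x i : ℝ)| ≤ (((finrank ℝ E : ℝ) + 1) * (B / r)) ^ finrank ℝ E := by
  classical
  set m := finrank ℝ E with hm
  set A : ℝ := ((m : ℝ) + 1) * (B / r) with hA
  have hBr : 1 ≤ B / r := (one_le_div hr).2 hrB
  have hA1 : 1 ≤ A := one_le_mul_of_one_le_of_one_le (by simp) hBr
  set X : ℕ := ⌊A ^ m⌋₊ with hX
  have hXle : (X : ℝ) ≤ A ^ m := Nat.floor_le (by positivity)
  have hXlt : A ^ m < X + 1 := Nat.lt_floor_add_one _
  set box : Finset (ι → ℕ) :=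
    Fintype.piFinset fun i => if i ∈ S then Finset.range (X + 1) else {0} with hbox
  have hcard : box.card = (X + 1) ^ (m + 1) := by
    rw [hbox, Fintype.card_piFinset, ← hS, ← Finset.prod_const,
      ← Finset.prod_subset (Finset.subset_univ S)]
    · exact Finset.prod_congr rfl fun i hi => by simp [hi]
    · intro i _ hi
      simp [hi]
  have hmem : ∀ x ∈ box, (∀ i ∈ S, x i ≤ X) ∧ ∀ i ∉ S, x i = 0 := by
    intro x hx
    rw [hbox, Fintype.mem_piFinset] at hx
    refine ⟨fun i hi => ?_, fun i hi => ?_⟩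
    · have := hx i
      simp only [hi, if_true, Finset.mem_range] at this
      omega
    · simpa [hi] using hx i
  set f : (ι → ℕ) → E := fun x => ∑ i, (x i : ℝ) • v i with hf
  have hsub : ∀ x y : ι → ℕ,
      f x - f y = ∑ i, ((((x i : ℤ) - (y i : ℤ) : ℤ)) : ℝ) • v i := by
    intro x y
    simp only [hf, ← Finset.sum_sub_distrib, ← sub_smul]
    push_cast
    rfl
  obtain ⟨x, hx, y, hy, hxy, hfxy⟩ : ∃ x ∈ box, ∃ y ∈ box, x ≠ y ∧ f x = f y := by
    by_contra! hcon
    have hinj : Set.InjOn f box := fun x hx y hy h => by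
      by_contra hne
      exact hcon x hx y hy hne h
    have hle := card_le_of_separated_of_dist_le (box.image f)
      (∑ i ∈ S, ((X : ℝ) / 2) • v i) (r := r) (R := ((m : ℝ) + 1) * (X / 2 * B)) hr
      (by have : 0 ≤ B := hr.le.trans hrB
          positivity) ?_ ?_
    · rw [Finset.card_image_of_injOn hinj, hcard, ← hm] at hle
      have h1 : 2 * (((m : ℝ) + 1) * (X / 2 * B)) / r + 1 ≤ A * (X + 1) := by
        have : 2 * (((m : ℝ) + 1) * (X / 2 * B)) / r = A * X := by
          rw [hA]; field_simp
        rw [this]; linarith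
      have h2 : ((X : ℝ) + 1) ^ (m + 1) ≤ A ^ m * (X + 1) ^ m := by
        rw [← mul_pow]
        push_cast at hle
        refine hle.trans (pow_le_pow_left₀ ?_ h1 m)
        have : 0 ≤ B := hr.le.trans hrB
        positivity
      rw [pow_succ, mul_comm] at h2
      exact absurd (le_of_mul_le_mul_right h2 (by positivity)) (not_le.2 hXlt)
    · intro z hz
      obtain ⟨x, hx, rfl⟩ := Finset.mem_image.1 hz
      obtain ⟨h1, h2⟩ := hmem x hx
      have : f x = ∑ i ∈ S, (x i : ℝ) • v i :=
        (Finset.sum_subset (Finset.subset_univ S) fun i _ hi => by simp [h2 i hi]).symm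
      rw [this, dist_eq_norm, ← Finset.sum_sub_distrib]
      calc _ ≤ ∑ i ∈ S, (X : ℝ) / 2 * B := by
            refine norm_sum_le_of_le S fun i hi => ?_
            rw [← sub_smul, norm_smul]
            refine mul_le_mul ?_ (hv i) (norm_nonneg _) (by positivity)
            have h3 : (x i : ℝ) ≤ X := by exact_mod_cast h1 i hi
            have h4 : (0 : ℝ) ≤ x i := by positivity
            rw [Real.norm_eq_abs, abs_le]
            constructor <;> linarith
        _ = _ := by rw [Finset.sum_const, nsmul_eq_mul, hS]; push_cast; rfl
    · intro a ha b hb hab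
      obtain ⟨x, hx, rfl⟩ := Finset.mem_image.1 ha
      obtain ⟨y, hy, rfl⟩ := Finset.mem_image.1 hb
      rw [dist_eq_norm, hsub]
      apply hmin
      rw [← hsub]
      exact sub_ne_zero.2 hab
  refine ⟨fun i => (x i : ℤ) - (y i : ℤ), ?_, ?_, ?_, ?_⟩
  · intro h
    apply hxy
    funext i
    have := congrFun h i
    simp only [Pi.zero_apply] at this
    omega
  · intro i hi
    simp [(hmem x hx).2 i hi, (hmem y hy).2 i hi]
  · rw [← hsub, hfxy, sub_self]
  · intro i
    refine le_trans ?_ hXle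
    have hx' : x i ≤ X := by
      by_cases hi : i ∈ S
      · exact (hmem x hx).1 i hi
      · simp [(hmem x hx).2 i hi]
    have hy' : y i ≤ X := by
      by_cases hi : i ∈ S
      · exact (hmem y hy).1 i hi
      · simp [(hmem y hy).2 i hi]
    have : |(x i : ℤ) - (y i : ℤ)| ≤ X := by
      rw [abs_le]; omega
    exact_mod_cast this

open Module in
/-- If `v` restricted to `J` is linearly independent, the relation module of `v` has rank at most
the size of the complement of `J`. -/
theorem finrank_relations_le {E ι : Type*} [AddCommGroup E] [Module ℝ E] [Fintype ι]
    [DecidableEq ι] (v : ι → E) (J : Finset ι)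
    (hJ : ∀ x : ι → ℤ, (∀ i ∉ J, x i = 0) → ∑ i, (x i : ℝ) • v i = 0 → x = 0)
    (M : Submodule ℤ (ι → ℤ)) (hM : ∀ x ∈ M, ∑ i, (x i : ℝ) • v i = 0) :
    finrank ℤ M ≤ Jᶜ.card := by
  let p : M →ₗ[ℤ] ((Jᶜ : Finset ι) → ℤ) :=
    (LinearMap.funLeft ℤ ℤ (Subtype.val : (Jᶜ : Finset ι) → ι)) ∘ₗ M.subtype
  have hp : Function.Injective p := by
    rw [injective_iff_map_eq_zero]
    intro x hx
    apply Subtype.ext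
    refine hJ x (fun i hi => ?_) (hM x x.2)
    exact congrFun hx ⟨i, Finset.mem_compl.2 hi⟩
  simpa only [finrank_fintype_fun_eq_card, Fintype.card_coe] using LinearMap.finrank_le_finrank_of_injective hp


/-- Let `v₁,…,v_s ∈ ℝⁿ` be vectors whose `ℤ`-span `Λ` is a nonzero lattice
(a nonzero discrete subgroup), let `B = max_i ‖v_i‖`, let `λ = √(λ₁(Λ))` where
`λ₁(Λ)` is the minimal square norm of a nonzero element of `Λ`, and let
`M = {x ∈ ℤ^s : Σ_i x_i v_i = 0}` (given with its defining property). If `M` has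
rank `k`, then there exist linearly independent `u₁,…,u_k ∈ M` with
`‖u_i‖² ≤ (n+1)^{2n+1}·(B/λ)^{2n}` for all `i`. -/
theorem stmt_1 (n s : ℕ) (v : Fin s → EuclideanSpace ℝ (Fin n))
    (hΛ : Submodule.span ℤ (Set.range v) ≠ ⊥)
    (hdisc : ∃ ε : ℝ, 0 < ε ∧
      ∀ x ∈ Submodule.span ℤ (Set.range v), x ≠ 0 → ε ≤ ‖x‖ ^ 2)
    (B : ℝ) (hB : B = ⨆ i : Fin s, ‖v i‖)
    (lam : ℝ) (hlam : lam = Real.sqrt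
      (sInf {r : ℝ | ∃ x ∈ Submodule.span ℤ (Set.range v), x ≠ 0 ∧ r = ‖x‖ ^ 2}))
    (M : Submodule ℤ (Fin s → ℤ))
    (hM : ∀ x : Fin s → ℤ, x ∈ M ↔ ∑ i : Fin s, (x i : ℝ) • v i = 0)
    (k : ℕ) (hk : Module.finrank ℤ M = k) :
    ∃ u : Fin k → (Fin s → ℤ),
      (∀ i, u i ∈ M) ∧ LinearIndependent ℤ u ∧
      ∀ i, (∑ j : Fin s, (u i j : ℝ) ^ 2) ≤ ((n : ℝ) + 1) ^ (2 * n + 1) * (B / lam) ^ (2 * n) := by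
  classical
  obtain ⟨ε, hε, hdisc⟩ := hdisc
  set L : Set ℝ := {r : ℝ | ∃ x ∈ Submodule.span ℤ (Set.range v), x ≠ 0 ∧ r = ‖x‖ ^ 2} with hL
  have hLε : ε ∈ lowerBounds L := by
    rintro _ ⟨x, hx, hx0, rfl⟩
    exact hdisc x hx hx0
  have hLne : L.Nonempty := by
    obtain ⟨x, hx, hx0⟩ := (Submodule.ne_bot_iff _).1 hΛ
    exact ⟨_, x, hx, hx0, rfl⟩
  have hlam0 : 0 < lam := by
    rw [hlam]
    exact Real.sqrt_pos.2 (hε.trans_le (le_csInf hLne hLε))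
  have hlamle : ∀ x ∈ Submodule.span ℤ (Set.range v), x ≠ 0 → lam ≤ ‖x‖ := by
    intro x hx hx0
    rw [hlam]
    exact Real.sqrt_le_iff.2 ⟨norm_nonneg _, csInf_le ⟨ε, hLε⟩ ⟨x, hx, hx0, rfl⟩⟩
  have hvB : ∀ i, ‖v i‖ ≤ B := by
    intro i
    rw [hB]
    exact le_ciSup (f := fun i => ‖v i‖) (Set.finite_range _).bddAbove i
  have hlamB : lam ≤ B := by
    obtain ⟨i, hi⟩ : ∃ i, v i ≠ 0 := by
      by_contra! h
      apply hΛ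
      rw [Submodule.span_eq_bot]
      rintro _ ⟨i, rfl⟩
      exact h i
    exact (hlamle _ (Submodule.subset_span ⟨i, rfl⟩) hi).trans (hvB i)
  set E := Submodule.span ℝ (Set.range v) with hE
  set m := Module.finrank ℝ E with hm
  have hmn : m ≤ n := by
    simpa using Submodule.finrank_le E
  let w : Fin s → E := fun i => ⟨v i, Submodule.subset_span ⟨i, rfl⟩⟩
  have hw : ∀ x : Fin s → ℤ, ((∑ i, (x i : ℝ) • w i : E) : EuclideanSpace ℝ (Fin n)) =
      ∑ i, (x i : ℝ) • v i := by
    intro x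
    simp [w]
  obtain ⟨κ, a, ha, hspan, hli⟩ := exists_linearIndependent' ℝ v
  have : Finite κ := Finite.of_injective a ha
  have : Fintype κ := Fintype.ofFinite κ
  set J : Finset (Fin s) := Finset.univ.map ⟨a, ha⟩ with hJ
  have hJcard : J.card = m := by
    rw [hJ, Finset.card_map, Finset.card_univ, hm, hE, ← hspan, finrank_span_eq_card hli]
  have hJli : ∀ x : Fin s → ℤ, (∀ i ∉ J, x i = 0) → ∑ i, (x i : ℝ) • v i = 0 → x = 0 := by
    intro x hx h
    rw [← Finset.sum_subset (Finset.subset_univ J) (fun i _ hi => by simp [hx i hi]), hJ,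
      Finset.sum_map] at h
    have h0 := Fintype.linearIndependent_iff.1 hli (fun i => (x (a i) : ℝ)) h
    funext i
    by_cases hi : i ∈ J
    · obtain ⟨j, -, rfl⟩ := Finset.mem_map.1 hi
      exact_mod_cast h0 j
    · exact hx i hi
  have hkJ : k ≤ Jᶜ.card := hk ▸ finrank_relations_le v J hJli M fun x hx => (hM x).1 hx
  have hrel : ∀ j : (Jᶜ : Finset (Fin s)), ∃ x : Fin s → ℤ, x ≠ 0 ∧
      (∀ i ∉ insert j.1 J, x i = 0) ∧ ∑ i, (x i : ℝ) • w i = 0 ∧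
      ∀ i, |(x i : ℝ)| ≤ (((m : ℝ) + 1) * (B / lam)) ^ m := by
    intro j
    refine exists_int_relation_abs_le w hlam0 hlamB hvB ?_ _ ?_
    · intro x hx
      rw [← Submodule.norm_coe, hw]
      refine hlamle _ (Submodule.sum_mem _ fun i _ => ?_) ?_
      · rw [Int.cast_smul_eq_zsmul]
        exact Submodule.smul_mem _ _ (Submodule.subset_span ⟨i, rfl⟩)
      · rw [← hw]
        exact fun h => hx (Subtype.ext h)
    · rw [Finset.card_insert_of_notMem (Finset.mem_compl.1 j.2), hJcard]
  choose x hx0 hxS hxw hxle using hrel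
  have hxv : ∀ j, ∑ i, (x j i : ℝ) • v i = 0 := by
    intro j
    rw [← hw, hxw]
    rfl
  have hxj : ∀ j, x j j ≠ 0 := by
    intro j h
    refine hx0 j (hJli _ (fun i hi => ?_) (hxv j))
    by_cases hij : i = j
    · rw [hij, h]
    · exact hxS j i (by simp [hij, hi])
  have hxne : ∀ j l : (Jᶜ : Finset (Fin s)), j ≠ l → x j l = 0 := by
    intro j l hjl
    refine hxS j l ?_
    rw [Finset.mem_insert, not_or]
    exact ⟨fun h => hjl (Subtype.ext h.symm), Finset.mem_compl.1 l.2⟩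
  have hxli : LinearIndependent ℤ x := by
    rw [Fintype.linearIndependent_iff]
    intro g hg l
    have h := congrFun hg l
    rw [Finset.sum_apply, Finset.sum_eq_single l (fun j _ hj => by simp [hxne j l hj])
      (by simp)] at h
    simpa [hxj l] using h
  have hBl : 1 ≤ B / lam := (one_le_div hlam0).2 hlamB
  have hsq : ∀ j, ∑ i, (x j i : ℝ) ^ 2 ≤ ((n : ℝ) + 1) ^ (2 * n + 1) * (B / lam) ^ (2 * n) := by
    intro j
    have hmn' : (m : ℝ) ≤ n := by exact_mod_cast hmn
    have hpow : (((m : ℝ) + 1) * (B / lam)) ^ m ≤ (((n : ℝ) + 1) * (B / lam)) ^ n :=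
      calc _ ≤ (((n : ℝ) + 1) * (B / lam)) ^ m := by gcongr
        _ ≤ _ := pow_le_pow_right₀ (one_le_mul_of_one_le_of_one_le (by simp) hBl) hmn
    calc ∑ i, (x j i : ℝ) ^ 2 = ∑ i ∈ insert j.1 J, (x j i : ℝ) ^ 2 :=
          (Finset.sum_subset (Finset.subset_univ _) fun i _ hi => by simp [hxS j i hi]).symm
      _ ≤ (insert j.1 J).card • ((((n : ℝ) + 1) * (B / lam)) ^ n) ^ 2 :=
          Finset.sum_le_card_nsmul _ _ _ fun i _ => by
            rw [← sq_abs]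
            exact pow_le_pow_left₀ (abs_nonneg _) ((hxle j i).trans hpow) 2
      _ = ((m : ℝ) + 1) * ((((n : ℝ) + 1) * (B / lam)) ^ n) ^ 2 := by
          rw [Finset.card_insert_of_notMem (Finset.mem_compl.1 j.2), hJcard, nsmul_eq_mul]
          push_cast
          rfl
      _ ≤ ((n : ℝ) + 1) * ((((n : ℝ) + 1) * (B / lam)) ^ n) ^ 2 := by gcongr
      _ = _ := by rw [mul_pow]; ring
  let e : Fin k ↪ (Jᶜ : Finset (Fin s)) :=
    (Fin.castLEEmb hkJ).trans Jᶜ.equivFin.symm.toEmbedding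
  exact ⟨fun i => x (e i), fun i => (hM _).2 (hxv _), hxli.comp e e.injective, fun i => hsq _⟩
end

section
/- Let R ⊆ S be number rings with the same field of fractions K (so Q(R) = Q(S) = K). Then the map I ↦ SI from the group of invertible fractional ideals of R to the group of invertible fractional ideals of S is a surjective group homomorphism; in particular, for every invertible fractional ideal J of S there exists an invertible fractional ideal I of R with SI = J. -/
/-- `I` is an invertible fractional ideal of the subring `R` of the field `K`
(with `Q(R) = K`): it is a finitely generated `R`-submodule of `K` with
`I·K = K`, and `IJ = R` for some `R`-submodule `J` of `K`. -/
def IsInvertibleFractionalIdeal {K : Type*} [Field K] (R : Subring K)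
    (I : Submodule ↥R K) : Prop :=
  I.FG ∧ Submodule.span K (I : Set K) = ⊤ ∧ ∃ J : Submodule ↥R K, I * J = 1

/-- If `J` is invertible with inverse `J'`, then for every finite set of maximal ideals there is
an element `v` of `J'` such that `v J` is contained in none of them. -/
theorem exists_mem_forall_mul_notMem_of_mul_eq_one {A K : Type*} [CommRing A] [CommRing K]
    [Algebra A K] {J J' : Submodule A K} (h : J * J' = 1) (F : Finset (Ideal A))
    (hF : ∀ m ∈ F, m.IsMaximal) :
    ∃ v ∈ J', ∀ m ∈ F, ∃ x ∈ J, ∃ s ∉ m, algebraMap A K s = v * x := by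
  classical
  have hmul : ∀ a ∈ J, ∀ b ∈ J', ∃ t : A, algebraMap A K t = b * a := fun a ha b hb ↦ by
    have := h ▸ Submodule.mul_mem_mul ha hb
    rw [mul_comm b]
    exact Submodule.mem_one.1 this
  have h1 : ∀ m ∈ F, ∃ a ∈ J, ∃ b ∈ J', ∃ t ∉ m, algebraMap A K t = b * a := by
    intro m hm
    by_contra! hcon
    have hle : (1 : Submodule A K) ≤ Submodule.map (Algebra.linearMap A K) m := by
      rw [← h, Submodule.mul_le]
      intro a ha b hb
      obtain ⟨t, ht⟩ := hmul a ha b hb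
      refine ⟨t, ?_, by simpa [mul_comm a] using ht⟩
      by_contra htm
      exact hcon a ha b hb t htm ht
    obtain ⟨t, htm, ht⟩ := hle (Submodule.one_le.1 le_rfl)
    have ht0 : 1 - t ∈ m := by
      by_contra htm'
      refine hcon 0 (zero_mem _) 0 (zero_mem _) _ htm' ?_
      rw [map_sub, map_one, mul_zero, sub_eq_zero]
      exact ht.symm
    exact (hF m hm).ne_top ((Ideal.eq_top_iff_one m).2 (by simpa using add_mem ht0 htm))
  have h2 : ∀ m ∈ F, ∃ c ∉ m, ∀ m' ∈ F, m' ≠ m → c ∈ m' := by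
    intro m hm
    have hprime := (hF m hm).isPrime
    have hle : ¬ (F.erase m).inf id ≤ m := by
      rw [hprime.inf_le']
      rintro ⟨m', hm', hle⟩
      rw [Finset.mem_erase] at hm'
      exact hm'.1 ((hF m' hm'.2).eq_of_le (hF m hm).ne_top hle)
    obtain ⟨c, hc, hcm⟩ := SetLike.not_le_iff_exists.1 hle
    refine ⟨c, hcm, fun m' hm' hne ↦ ?_⟩
    exact (Finset.inf_le (f := id) (Finset.mem_erase.2 ⟨hne, hm'⟩)) hc
  choose! a ha b hb t htm ht using h1
  choose! c hcm hc using h2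
  refine ⟨∑ m ∈ F, c m • b m, sum_mem fun m hm ↦ J'.smul_mem _ (hb m hm), fun m hm ↦ ?_⟩
  have h3 : ∀ m' ∈ F, ∃ u : A, algebraMap A K u = b m' * a m := fun m' hm' ↦
    hmul _ (ha m hm) _ (hb m' hm')
  choose! u hu using h3
  have hprime := (hF m hm).isPrime
  refine ⟨a m, ha m hm, c m * t m + ∑ m' ∈ F.erase m, c m' * u m', ?_, ?_⟩
  · rw [Ideal.add_mem_iff_left]
    · exact fun hmem ↦ (hprime.mem_or_mem hmem).elim (hcm m hm) (htm m hm)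
    · refine sum_mem fun m' hm' ↦ Ideal.mul_mem_right _ _ ?_
      rw [Finset.mem_erase] at hm'
      exact hc m' hm'.2 m hm hm'.1.symm
  · rw [← Finset.add_sum_erase F _ hm, add_mul, Finset.sum_mul, map_add, map_sum, map_mul, ht m hm,
      Algebra.smul_def, mul_assoc]
    congr 1
    refine Finset.sum_congr rfl fun m' hm' ↦ ?_
    rw [map_mul, hu m' (Finset.mem_of_mem_erase hm'), Algebra.smul_def, mul_assoc]

/-- If `J` is invertible and `n` lies in only finitely many maximal ideals, then `J` is
principal modulo `n`. -/
theorem exists_mul_eq_one_add_mul_of_mul_eq_one {A K : Type*} [CommRing A] [CommRing K]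
    [Algebra A K] {J J' : Submodule A K} (h : J * J' = 1) (n : A)
    (hn : {m : Ideal A | m.IsMaximal ∧ n ∈ m}.Finite) :
    ∃ v ∈ J', ∃ x ∈ J, ∃ s : A, v * x = algebraMap A K (1 + n * s) := by
  obtain ⟨v, hv, hvm⟩ := exists_mem_forall_mul_notMem_of_mul_eq_one h hn.toFinset
    (fun m hm ↦ (hn.mem_toFinset.1 hm).1)
  refine ⟨v, hv, ?_⟩
  let I : Ideal A := (J.map (LinearMap.mulLeft A v)).comap (Algebra.linearMap A K)
  have htop : I ⊔ Ideal.span {n} = ⊤ := by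
    by_contra hne
    obtain ⟨m, hm, hle⟩ := Ideal.exists_le_maximal _ hne
    obtain ⟨x, hx, s, hs, e⟩ := hvm m (hn.mem_toFinset.2
      ⟨hm, hle (Ideal.mem_sup_right (Ideal.mem_span_singleton_self n))⟩)
    exact hs (hle (Ideal.mem_sup_left ⟨x, hx, e.symm⟩))
  obtain ⟨e, ⟨x, hx, he⟩, y, hy, hey⟩ :=
    Submodule.mem_sup.1 (htop ▸ Submodule.mem_top : (1 : A) ∈ I ⊔ Ideal.span {n})
  obtain ⟨s, rfl⟩ := Ideal.mem_span_singleton'.1 hy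
  refine ⟨x, hx, -s, ?_⟩
  rw [show 1 + n * -s = e by rw [← hey]; ring]
  exact he

theorem Submodule.span_subring_span {K : Type*} [Field K] {R S : Subring K} (hRS : R ≤ S)
    (X : Set K) : span S (span R X : Set K) = span S X := by
  refine le_antisymm (span_le.2 fun x hx ↦ ?_) (span_mono subset_span)
  induction hx using span_induction with
  | mem x hx => exact subset_span hx
  | zero => exact zero_mem _
  | add x y _ _ hx hy => exact add_mem hx hy
  | smul r x _ hx => exact smul_mem _ (⟨r, hRS r.2⟩ : S) hx

theorem exists_coprime_dvd_mul_pow (N : ℕ) {w : ℕ} (hw : w ≠ 0) :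
    ∃ L m : ℕ, L ≠ 0 ∧ L.Coprime N ∧ w ∣ L * N ^ m := by
  induction w using Nat.strong_induction_on with
  | _ w ih =>
    by_cases hc : w.Coprime N
    · exact ⟨w, 0, hw, hc, by simp⟩
    obtain ⟨w', hw'⟩ := Nat.gcd_dvd_left w N
    have hw'0 : w' ≠ 0 := by rintro rfl; simp at hw'; exact hw hw'
    have hlt : w' < w := by
      have : Nat.gcd w N ≠ 0 := Nat.gcd_ne_zero_left hw
      have : Nat.gcd w N ≠ 1 := hc
      have : 2 ≤ Nat.gcd w N := by omega
      nlinarith [Nat.pos_of_ne_zero hw'0]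
    obtain ⟨L, m, hL0, hL, hd⟩ := ih w' hlt hw'0
    refine ⟨L, m + 1, hL0, hL, ?_⟩
    rw [hw', pow_succ, ← mul_assoc, mul_comm _ w']
    exact mul_dvd_mul hd (Nat.gcd_dvd_right w N)

section

variable {K : Type*} [Field K] [NumberField K]

theorem Subring.exists_natCast_mul_mem (R : Subring K) [IsFractionRing R K] (x : K) :
    ∃ n : ℕ, n ≠ 0 ∧ (n : K) * x ∈ R := by
  obtain ⟨a, b, hb, rfl⟩ := IsFractionRing.div_surjective (A := R) x
  have hbalg : IsAlgebraic ℤ b := by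
    have : IsAlgebraic ℤ (algebraMap R K b) :=
      (IsFractionRing.isAlgebraic_iff ℤ ℚ K).2 (Algebra.IsAlgebraic.isAlgebraic _)
    exact (isAlgebraic_algebraMap_iff (IsFractionRing.injective R K)).1 this
  obtain ⟨n, hn, c, hc⟩ := hbalg.exists_nonzero_dvd hb
  have hb0 : (algebraMap R K b) ≠ 0 := by
    simpa using nonZeroDivisors.ne_zero hb
  have hn' : ((n : ℤ) : K) * (algebraMap R K a / algebraMap R K b) = algebraMap R K (c * a) := by
    have := congrArg (algebraMap R K) hc
    rw [map_mul, ← IsScalarTower.algebraMap_apply ℤ R K] at this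
    rw [eq_intCast] at this
    rw [this, map_mul]
    field_simp
  refine ⟨n.natAbs, by simpa using hn, ?_⟩
  rcases Int.natAbs_eq n with h | h
  · rw [h] at hn'
    simp only [Int.cast_natCast] at hn'
    rw [hn']; exact (c * a).2
  · rw [h] at hn'
    simp only [Int.cast_neg, Int.cast_natCast] at hn'
    rw [← neg_mem_iff, ← neg_mul, hn']; exact (c * a).2

theorem Subring.finite_quotient_span_natCast (S : Subring K) {n : ℕ} (hn : n ≠ 0) :
    Finite (S ⧸ Ideal.span {(n : S)}) := by
  classical
  by_contra hinf
  rw [not_finite_iff_infinite] at hinf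
  obtain ⟨s, hs⟩ := Infinite.exists_subset_card_eq (S ⧸ Ideal.span {(n : S)})
    (n ^ Module.finrank ℚ K + 1)
  let M : Submodule ℤ S := Submodule.span ℤ (s.image Quotient.out : Finset S)
  have : NeZero n := ⟨hn⟩
  have : Module.Finite ℤ M := .span_finset _ _
  have : Module.IsTorsionFree ℤ M := inferInstance
  let b := Module.finBasis ℤ M
  have hrank : Module.finrank ℤ M ≤ Module.finrank ℚ K := by
    have hli : LinearIndependent ℤ (fun i ↦ ((b i : S) : K)) :=
      b.linearIndependent.map' ((S.subtype.toAddMonoidHom.toIntLinearMap).comp M.subtype)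
        (LinearMap.ker_eq_bot.2 (Subtype.val_injective.comp Subtype.val_injective))
    have := ((LinearIndependent.iff_fractionRing ℤ ℚ).1 hli).fintype_card_le_finrank
    simpa using this
  let f : S ⧸ Ideal.span {(n : S)} → (Fin (Module.finrank ℤ M) → ZMod n) := fun q i ↦
    if h : Quotient.out q ∈ M then ((b.repr ⟨_, h⟩ i : ℤ) : ZMod n) else 0
  obtain ⟨q, hq, q', hq', hne, hf⟩ := Finset.exists_ne_map_eq_of_card_lt_of_maps_to (s := s)
    (t := Finset.univ) (f := f) (by
      rw [hs]
      simp only [Finset.card_univ, Fintype.card_pi, ZMod.card, Finset.prod_const, Fintype.card_fin]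
      exact Nat.lt_succ_of_le (Nat.pow_le_pow_right (Nat.pos_of_ne_zero hn) hrank))
    (fun _ _ ↦ by simp)
  have hM : ∀ q ∈ s, Quotient.out q ∈ M := fun q hq ↦
    Submodule.subset_span (by simpa using Finset.mem_image_of_mem Quotient.out hq)
  apply hne
  rw [← Quotient.out_eq q, ← Quotient.out_eq q']
  refine Ideal.Quotient.eq.2 ?_
  have hdvd : ∀ i, (n : ℤ) ∣ b.repr (⟨_, hM q hq⟩ - ⟨_, hM q' hq'⟩) i := by
    intro i
    have := congrFun hf i
    simp only [f, dif_pos (hM q hq), dif_pos (hM q' hq')] at this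
    rw [← ZMod.intCast_zmod_eq_zero_iff_dvd]
    simp [this]
  choose c hc using hdvd
  have hsum := b.sum_repr (⟨_, hM q hq⟩ - ⟨_, hM q' hq'⟩)
  have hsum' := congrArg (Subtype.val) hsum
  refine Ideal.mem_span_singleton.2 ⟨((∑ i, c i • b i : M) : S), ?_⟩
  refine hsum'.symm.trans ?_
  simp only [hc]
  simp [Finset.mul_sum, mul_assoc]

theorem Subring.finite_setOf_isMaximal_natCast_mem (S : Subring K) {n : ℕ} (hn : n ≠ 0) :
    {m : Ideal S | m.IsMaximal ∧ (n : S) ∈ m}.Finite := by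
  have := S.finite_quotient_span_natCast hn
  have : {I | Ideal.comap (Ideal.Quotient.mk (Ideal.span {(n : S)})) ⊥ ≤ I}.Finite :=
    .of_equiv _ (Ideal.relIsoOfSurjective _ Ideal.Quotient.mk_surjective).toEquiv
  refine this.subset fun m hm ↦ ?_
  simpa [← RingHom.ker_eq_comap_bot] using hm.2

theorem exists_isUnit_span_subring_eq {R S : Subring K} (hRS : R ≤ S) [IsFractionRing R K]
    [IsFractionRing S K] {J : Submodule S K} (hJ : IsUnit J) (hJ1 : J ≤ 1) :
    ∃ I : Submodule R K, IsUnit I ∧ Submodule.span S (I : Set K) = J := by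
  obtain ⟨J', h⟩ := hJ.exists_right_inv
  have hmul : ∀ a ∈ J, ∀ b ∈ J', b * a ∈ S := fun a ha b hb ↦ by
    obtain ⟨t, ht⟩ := Submodule.mem_one.1 (h ▸ Submodule.mul_mem_mul ha hb)
    rw [mul_comm, ← ht]
    exact t.2
  have halg (t : S) : algebraMap S K t = t := rfl
  obtain ⟨N, hN, hNJ⟩ : ∃ N : ℕ, N ≠ 0 ∧ (N : K) ∈ J := by
    obtain ⟨z, hz, hz0⟩ := Submodule.exists_mem_ne_zero_of_ne_bot hJ.ne_zero
    obtain ⟨N, hN, hNz⟩ := S.exists_natCast_mul_mem z⁻¹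
    exact ⟨N, hN, by simpa [Subring.smul_def, hz0] using J.smul_mem ⟨_, hNz⟩ hz⟩
  obtain ⟨v, hv, x, hx, hx0, s, hs⟩ :
      ∃ v ∈ J', ∃ x ∈ J, x ≠ 0 ∧ ∃ s : S, v * x = 1 + N * s := by
    obtain ⟨v, hv, x, hx, s, hs⟩ := exists_mul_eq_one_add_mul_of_mul_eq_one h (N : S)
      (S.finite_setOf_isMaximal_natCast_mem hN)
    replace hs : v * x = 1 + N * s := by rw [hs, halg]; simp
    by_cases hx0 : x = 0
    · refine ⟨v, hv, (N : S) • (N : K), J.smul_mem _ hNJ, ?_, ⟨_, hmul _ hNJ _ hv⟩ + s, ?_⟩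
      · simp [Subring.smul_def, hN]
      · simp only [Subring.smul_def, smul_eq_mul, Subring.coe_natCast, Subring.coe_add]
        rw [hx0] at hs
        linear_combination hs
    · exact ⟨v, hv, x, hx, hx0, s, hs⟩
  have key (y : K) (T : Subring K) [IsFractionRing T K] :
      ∃ L m : ℕ, L ≠ 0 ∧ L.Coprime N ∧ (L : K) * N ^ m * y ∈ T := by
    obtain ⟨w, hw, hwy⟩ := T.exists_natCast_mul_mem y
    obtain ⟨L, m, hL0, hL, c, hc⟩ := exists_coprime_dvd_mul_pow N hw
    refine ⟨L, m, hL0, hL, ?_⟩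
    have : (L : K) * N ^ m = c * w := by exact_mod_cast hc.trans (mul_comm _ _)
    rw [this, mul_assoc]
    exact mul_mem (natCast_mem T c) hwy
  obtain ⟨L₀, k, hL₀0, hL₀, hk⟩ := key x R
  set y : K := L₀ * x with hy
  have hy0 : y ≠ 0 := mul_ne_zero (by exact_mod_cast hL₀0) hx0
  have hyJ : y ∈ J := by simpa [Subring.smul_def] using J.smul_mem (L₀ : S) hx
  obtain ⟨L, m, -, hL, hm⟩ := key y⁻¹ R
  have hNm : (N : K) ^ (m + 1) ∈ J := by
    simpa [Subring.smul_def, pow_succ] using J.smul_mem ((N : S) ^ m) hNJ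
  refine ⟨Submodule.span R {y, (N : K) ^ (m + 1)},
    .of_mul_eq_one (Submodule.span R {L * y⁻¹, (N : K) ^ k}) (le_antisymm ?_ ?_), ?_⟩
  · have h_one {z : K} (hz : z ∈ R) : z ∈ (1 : Submodule R K) := Submodule.mem_one.2 ⟨⟨z, hz⟩, rfl⟩
    rw [Submodule.span_mul_span, Submodule.span_le]
    rintro _ ⟨a, rfl | rfl, b, rfl | rfl, rfl⟩ <;> refine h_one ?_ <;> dsimp only
    · rw [mul_left_comm]
      simp [hy0]
    · convert hk using 1
      simp only [hy]
      ring
    · convert mul_mem (natCast_mem R N) hm using 1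
      ring
    · exact mul_mem (pow_mem (natCast_mem R N) _) (pow_mem (natCast_mem R N) _)
  · rw [Submodule.one_le]
    obtain ⟨a, b, hab⟩ : IsCoprime (L : ℤ) ((N : ℤ) ^ (m + 1 + k)) :=
      (Nat.isCoprime_iff_coprime.2 hL).pow_right
    have hab' : (a : K) * L + b * N ^ (m + 1 + k) = 1 := by exact_mod_cast hab
    have h1 : (1 : K) = (a : R) • (y * (L * y⁻¹)) +
        (b : R) • ((N : K) ^ (m + 1) * (N : K) ^ k) := by
      simp only [Subring.smul_def, smul_eq_mul, Subring.coe_intCast]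
      rw [← hab']
      field_simp
      ring
    rw [h1]
    refine add_mem (Submodule.smul_mem _ _ (Submodule.mul_mem_mul ?_ ?_))
      (Submodule.smul_mem _ _ (Submodule.mul_mem_mul ?_ ?_)) <;>
    exact Submodule.subset_span (by simp)
  rw [Submodule.span_subring_span hRS]
  apply le_antisymm
  · rw [Submodule.span_le]
    rintro _ (rfl | rfl)
    exacts [hyJ, hNm]
  · intro j hj
    obtain ⟨t, rfl⟩ := Submodule.mem_one.1 (hJ1 hj)
    have hco : IsCoprime ((L₀ : S) * (1 + N * s)) ((N : S) ^ (m + 1)) := by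
      refine (IsCoprime.mul_left ?_ ⟨1, -s, by ring⟩).pow_right
      simpa using (Nat.isCoprime_iff_coprime.2 hL₀).map (Int.castRingHom S)
    obtain ⟨a, b, hab⟩ := hco
    have hab' : (a : K) * (L₀ * (1 + N * s)) + b * (N : K) ^ (m + 1) = 1 := by
      simpa using congrArg Subtype.val hab
    have ht : (t : K) = (a * ⟨_, hmul _ hj _ hv⟩ : S) • y + (b * t : S) • (N : K) ^ (m + 1) := by
      simp only [Subring.smul_def, smul_eq_mul, Subring.coe_mul, hy, halg]
      linear_combination -(t : K) * hab' - (a : K) * L₀ * t * hs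
    rw [halg, ht]
    exact add_mem (Submodule.smul_mem _ _ (Submodule.subset_span (by simp)))
      (Submodule.smul_mem _ _ (Submodule.subset_span (by simp)))

end

theorem Submodule.span_subring_mul {K : Type*} [Field K] {R : Subring K} (S : Subring K)
    (I₁ I₂ : Submodule R K) :
    span S ((I₁ * I₂ : Submodule R K) : Set K) = span S (I₁ : Set K) * span S (I₂ : Set K) := by
  apply le_antisymm
  · rw [span_le]
    intro x hx
    induction hx using Submodule.mul_induction_on' with
    | mem_mul_mem a ha b hb => exact mul_mem_mul (subset_span ha) (subset_span hb)
    | add x _ y _ hx hy => exact add_mem hx hy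
  · rw [span_mul_span, span_le]
    rintro _ ⟨a, ha, b, hb, rfl⟩
    exact subset_span (mul_mem_mul ha hb)

theorem Submodule.span_subring_one {K : Type*} [Field K] {R S : Subring K} (hRS : R ≤ S) :
    span S ((1 : Submodule R K) : Set K) = 1 := by
  apply le_antisymm
  · rw [span_le]
    rintro x hx
    obtain ⟨r, rfl⟩ := mem_one.1 hx
    exact mem_one.2 ⟨⟨r, hRS r.2⟩, rfl⟩
  · exact one_le.2 (subset_span (one_le.1 le_rfl))

theorem Submodule.isUnit_span_subring {K : Type*} [Field K] {R S : Subring K} (hRS : R ≤ S)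
    {I : Submodule R K} (hI : IsUnit I) : IsUnit (span S (I : Set K)) := by
  obtain ⟨J, h⟩ := hI.exists_right_inv
  exact .of_mul_eq_one (span S (J : Set K)) (by rw [← span_subring_mul, h, span_subring_one hRS])

theorem isInvertibleFractionalIdeal_iff {K : Type*} [Field K] {R : Subring K}
    {I : Submodule R K} : IsInvertibleFractionalIdeal R I ↔ IsUnit I := by
  refine ⟨fun ⟨_, _, J, h⟩ ↦ .of_mul_eq_one J h,
    fun h ↦ ⟨Submodule.fg_of_isUnit h, ?_, h.exists_right_inv⟩⟩
  obtain ⟨z, hz, hz0⟩ := Submodule.exists_mem_ne_zero_of_ne_bot h.ne_zero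
  exact Ideal.eq_top_of_isUnit_mem _ (Submodule.subset_span hz) hz0.isUnit

/-- Let `R ⊆ S` be number rings with the same field of fractions `K`. Then
`I ↦ SI` is a surjective group homomorphism from the group of invertible
fractional ideals of `R` to the group of invertible fractional ideals of `S`:
it is multiplicative, sends invertible fractional ideals of `R` to invertible
fractional ideals of `S`, and every invertible fractional ideal of `S` is of the
form `SI` for an invertible fractional ideal `I` of `R`. -/
theorem stmt_4 {K : Type*} [Field K] [NumberField K] (R S : Subring K) (hRS : R ≤ S)
    [IsFractionRing ↥R K] [IsFractionRing ↥S K] :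
    (∀ I₁ I₂ : Submodule ↥R K,
        IsInvertibleFractionalIdeal R I₁ → IsInvertibleFractionalIdeal R I₂ →
        Submodule.span ↥S ((I₁ * I₂ : Submodule ↥R K) : Set K) =
          Submodule.span ↥S (I₁ : Set K) * Submodule.span ↥S (I₂ : Set K)) ∧
    (∀ I : Submodule ↥R K, IsInvertibleFractionalIdeal R I →
        IsInvertibleFractionalIdeal S (Submodule.span ↥S (I : Set K))) ∧
    (∀ J : Submodule ↥S K, IsInvertibleFractionalIdeal S J →
        ∃ I : Submodule ↥R K, IsInvertibleFractionalIdeal R I ∧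
          Submodule.span ↥S (I : Set K) = J) := by
  simp only [isInvertibleFractionalIdeal_iff]
  refine ⟨fun I₁ I₂ _ _ ↦ Submodule.span_subring_mul S I₁ I₂,
    fun I ↦ Submodule.isUnit_span_subring hRS, fun J hJ ↦ ?_⟩
  obtain ⟨d, hd, hdJ⟩ : ∃ d : K, d ≠ 0 ∧ ∀ x ∈ J, d * x ∈ S := by
    obtain ⟨J', h⟩ := hJ.exists_left_inv
    obtain ⟨d, hd, hd0⟩ :=
      Submodule.exists_mem_ne_zero_of_ne_bot (IsUnit.of_mul_eq_one J h).ne_zero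
    refine ⟨d, hd0, fun x hx ↦ ?_⟩
    obtain ⟨t, ht⟩ := Submodule.mem_one.1 (h ▸ Submodule.mul_mem_mul hd hx)
    exact ht ▸ t.2
  have hunit (T : Subring K) : Submodule.span T {d} * Submodule.span T {d⁻¹} = 1 := by
    rw [Submodule.span_mul_span, Set.singleton_mul_singleton, mul_inv_cancel₀ hd,
      Submodule.one_eq_span]
  have hunit' (T : Subring K) : Submodule.span T {d⁻¹} * Submodule.span T {d} = 1 := by
    rw [mul_comm, hunit]
  obtain ⟨I, hI, hIJ⟩ := exists_isUnit_span_subring_eq hRS (J := Submodule.span S {d} * J)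
    ((IsUnit.of_mul_eq_one _ (hunit S)).mul hJ) (by
      rw [Submodule.mul_le]
      intro a ha x hx
      obtain ⟨s, rfl⟩ := Submodule.mem_span_singleton.1 ha
      rw [smul_mul_assoc]
      exact Submodule.smul_mem _ _ (Submodule.mem_one.2 ⟨⟨_, hdJ x hx⟩, rfl⟩))
  refine ⟨Submodule.span R {d⁻¹} * I, (IsUnit.of_mul_eq_one _ (hunit' R)).mul hI, ?_⟩
  rw [Submodule.span_subring_mul, hIJ, Submodule.span_subring_span hRS, ← mul_assoc]
  rw [hunit', one_mul]
end

section
/- (Dade–Taussky–Zassenhaus) Let K be a number field, R ⊆ K a subring, and I ⊆ K a finitely generated nonzero R-submodule. Then the blowup Bl_K(I) equals (Iⁿ : Iⁿ)_K for every integer n ≥ [K:ℚ] − 1. Moreover, for any subring T ⊆ K we have Bl_K(I) ⊆ T if and only if the T-submodule TI of K is an invertible ideal of T within K. -/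
section

open Polynomial

variable {R A : Type*} [CommRing R] [CommRing A] [Algebra R A]

/-- The `R`-submodule generated by the coefficients of a polynomial. -/
def coeffSpan (R : Type*) {A : Type*} [CommRing R] [CommRing A] [Algebra R A] (f : A[X]) :
    Submodule R A := Submodule.span R (Set.range f.coeff)

theorem coeff_mem_coeffSpan (f : A[X]) (i : ℕ) : f.coeff i ∈ coeffSpan R f :=
  Submodule.subset_span ⟨i, rfl⟩

theorem coeffSpan_le {f : A[X]} {P : Submodule R A} :
    coeffSpan R f ≤ P ↔ ∀ i, f.coeff i ∈ P := by
  simp [coeffSpan, Submodule.span_le, Set.range_subset_iff]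

theorem coeffSpan_mul_le (f g : A[X]) :
    coeffSpan R (f * g) ≤ coeffSpan R f * coeffSpan R g := by
  refine coeffSpan_le.2 fun i ↦ ?_
  rw [coeff_mul]
  exact sum_mem fun x _ ↦
    Submodule.mul_mem_mul (coeff_mem_coeffSpan f _) (coeff_mem_coeffSpan g _)

theorem coeffSpan_add_le (f g : A[X]) :
    coeffSpan R (f + g) ≤ coeffSpan R f + coeffSpan R g := by
  refine coeffSpan_le.2 fun i ↦ ?_
  rw [coeff_add]
  exact Submodule.add_mem_sup (coeff_mem_coeffSpan f _) (coeff_mem_coeffSpan g _)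

theorem coeffSpan_sub_le (f g : A[X]) :
    coeffSpan R (f - g) ≤ coeffSpan R f + coeffSpan R g := by
  refine coeffSpan_le.2 fun i ↦ ?_
  rw [coeff_sub, sub_eq_add_neg]
  exact Submodule.add_mem_sup (coeff_mem_coeffSpan f _) (neg_mem (coeff_mem_coeffSpan g _))

@[simp]
theorem coeffSpan_zero : coeffSpan R (0 : A[X]) = 0 :=
  le_antisymm (coeffSpan_le.2 fun i ↦ by simp) bot_le

theorem coeffSpan_monomial (n : ℕ) (a : A) :
    coeffSpan R (monomial n a) = Submodule.span R {a} := by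
  refine le_antisymm (coeffSpan_le.2 fun i ↦ ?_) ?_
  · rw [coeff_monomial]
    split_ifs
    · exact Submodule.mem_span_singleton_self a
    · exact zero_mem _
  · rw [Submodule.span_singleton_le_iff_mem]
    simpa using coeff_mem_coeffSpan (R := R) (monomial n a) n

theorem coeffSpan_erase_le (f : A[X]) (n : ℕ) : coeffSpan R (f.erase n) ≤ coeffSpan R f := by
  refine coeffSpan_le.2 fun i ↦ ?_
  rw [coeff_erase]
  split_ifs
  · exact zero_mem _
  · exact coeff_mem_coeffSpan f i

theorem coeffSpan_le_erase_add (f : A[X]) (n : ℕ) :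
    coeffSpan R f ≤ coeffSpan R (f.erase n) + Submodule.span R {f.coeff n} := by
  conv_lhs => rw [← monomial_add_erase f n, add_comm]
  simpa only [coeffSpan_monomial] using
    coeffSpan_add_le (R := R) (f.erase n) (monomial n (f.coeff n))

theorem degree_erase_lt_of_degree_lt_succ {f : A[X]} {n : ℕ} (hf : f.degree < (n + 1 : ℕ)) :
    (f.erase n).degree < n := by
  rw [degree_lt_iff_coeff_zero] at hf ⊢
  intro m hm
  rw [coeff_erase]
  split_ifs with h
  · rfl
  · exact hf m (by omega)

theorem pow_succ_le_pow_succ_add_mul_pow {F F' P : Submodule R A} (h : F ≤ F' + P) (n : ℕ) :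
    F ^ (n + 1) ≤ F' ^ (n + 1) + P * (F' + P) ^ n := by
  grw [h]
  induction n with
  | zero => simp
  | succ n ih =>
    calc (F' + P) ^ (n + 1 + 1) = (F' + P) * (F' + P) ^ (n + 1) := pow_succ' _ _
      _ ≤ (F' + P) * (F' ^ (n + 1) + P * (F' + P) ^ n) := by gcongr
      _ = F' ^ (n + 2) + (P * F' ^ (n + 1) + P * (F' + P) ^ (n + 1)) := by ring
      _ ≤ F' ^ (n + 2) + (P * (F' + P) ^ (n + 1) + P * (F' + P) ^ (n + 1)) := by
        gcongr; exact le_sup_left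
      _ = _ := by rw [add_idem]

/-- The **Dedekind–Mertens lemma**. -/
theorem coeffSpan_pow_mul_le (m n : ℕ) (f g : A[X]) (hf : f.degree < n) (hg : g.degree < m) :
    coeffSpan R f ^ m * coeffSpan R g ≤ coeffSpan R f ^ (m - 1) * coeffSpan R (f * g) := by
  induction m generalizing n f g with
  | zero =>
    obtain rfl : g = 0 := by simpa using hg
    simp
  | succ m ihm =>
  induction n generalizing f with
  | zero =>
    obtain rfl : f = 0 := by simpa using hf
    simp
  | succ n ihn =>
    set a := f.coeff n
    set b := g.coeff m
    set P := Submodule.span R {a}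
    set Q := Submodule.span R {b}
    set F := coeffSpan R f
    set F' := coeffSpan R (f.erase n)
    set G := coeffSpan R g
    set G' := coeffSpan R (g.erase m)
    set H := coeffSpan R (f * g)
    have hFF' : F ≤ F' + P := coeffSpan_le_erase_add f n
    have hF'F : F' ≤ F := coeffSpan_erase_le f n
    have hPF : P ≤ F := (Submodule.span_singleton_le_iff_mem _ _).2 (coeff_mem_coeffSpan f n)
    have hQG : Q ≤ G := (Submodule.span_singleton_le_iff_mem _ _).2 (coeff_mem_coeffSpan g m)
    have hF : F' + P = F := le_antisymm (sup_le hF'F hPF) hFF'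
    have hGG' : G ≤ G' + Q := coeffSpan_le_erase_add g m
    have hPQ : P * Q ≤ H := by
      rw [Submodule.span_mul_span, Set.singleton_mul_singleton,
        Submodule.span_singleton_le_iff_mem]
      have : (f * g).coeff (n + m) = a * b := by
        refine coeff_mul_add_eq_of_natDegree_le ?_ ?_
        · exact natDegree_le_of_degree_le (Order.le_of_lt_succ hf)
        · exact natDegree_le_of_degree_le (Order.le_of_lt_succ hg)
      rw [← this]
      exact coeff_mem_coeffSpan _ _
    have h₁ : coeffSpan R (f * g.erase m) ≤ H + F * Q := by
      have : f * g.erase m = f * g - f * monomial m b := by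
        rw [← mul_sub]; congr 1; rw [eq_sub_iff_add_eq', monomial_add_erase]
      rw [this, ← show coeffSpan R (monomial m b) = Q from coeffSpan_monomial m b]
      exact (coeffSpan_sub_le _ _).trans (add_le_add_right (coeffSpan_mul_le _ _) _)
    have h₂ : coeffSpan R (f.erase n * g) ≤ H + P * G := by
      have : f.erase n * g = f * g - monomial n a * g := by
        rw [← sub_mul]; congr 1; rw [eq_sub_iff_add_eq', monomial_add_erase]
      rw [this, ← show coeffSpan R (monomial n a) = P from coeffSpan_monomial n a]
      exact (coeffSpan_sub_le _ _).trans (add_le_add_right (coeffSpan_mul_le _ _) _)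
    have h₃ : ∀ S ≤ F, S * F ^ m * G' ≤ F ^ m * H + F ^ m * (S * Q) := by
      intro S hS
      rcases m with _ | m
      · have : g.erase 0 = 0 := by
          simpa using degree_erase_lt_of_degree_lt_succ hg
        simp [G', this]
      · have := ihm (n + 1) f (g.erase (m + 1)) hf (degree_erase_lt_of_degree_lt_succ hg)
        calc S * F ^ (m + 1) * G' = S * (F ^ (m + 1) * G') := by ring
          _ ≤ S * (F ^ m * (H + F * Q)) := by grw [this, h₁]; simp [F]
          _ = S * F ^ m * H + F ^ (m + 1) * (S * Q) := by ring
          _ ≤ F * F ^ m * H + F ^ (m + 1) * (S * Q) := by gcongr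
          _ = _ := by ring
    have h₄ : P * F ^ m * G' ≤ F ^ m * H := by
      grw [h₃ P hPF, hPQ, add_idem]
    have h₅ : F' ^ (m + 1) * G ≤ F ^ m * H := by
      calc F' ^ (m + 1) * G ≤ F' ^ m * coeffSpan R (f.erase n * g) :=
            ihn _ (degree_erase_lt_of_degree_lt_succ hf)
        _ ≤ F ^ m * (H + P * (G' + Q)) := by grw [h₂, hF'F, hGG']
        _ = F ^ m * H + (P * F ^ m * G' + F ^ m * (P * Q)) := by ring
        _ ≤ _ := by grw [h₄, hPQ, add_idem, add_idem]
    have h₆ : F ^ (m + 1) * Q ≤ F ^ m * H := by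
      grw [pow_succ_le_pow_succ_add_mul_pow hFF' m, hF]
      calc (F' ^ (m + 1) + P * F ^ m) * Q = F' ^ (m + 1) * Q + F ^ m * (P * Q) := by ring
        _ ≤ F' ^ (m + 1) * G + F ^ m * H := by gcongr
        _ ≤ _ := by grw [h₅, add_idem]
    calc F ^ (m + 1) * G ≤ F ^ (m + 1) * (G' + Q) := by gcongr
      _ = F * F ^ m * G' + F ^ (m + 1) * Q := by ring
      _ ≤ F ^ m * H + F ^ m * (F * Q) + F ^ (m + 1) * Q := by grw [h₃ F le_rfl]
      _ = F ^ m * H + F ^ (m + 1) * Q + F ^ (m + 1) * Q := by ring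
      _ ≤ F ^ m * H := by grw [h₆, add_idem, add_idem]

theorem exists_coeffSpan_eq {P : Submodule R A} (hP : P.FG) : ∃ f : A[X], coeffSpan R f = P := by
  classical
  obtain ⟨n, s, rfl⟩ := Submodule.fg_iff_exists_fin_generating_family.1 hP
  refine ⟨ofFn n s, le_antisymm (coeffSpan_le.2 fun i ↦ ?_) ?_⟩
  · rcases lt_or_ge i n with h | h
    · rw [ofFn_coeff_eq_val_of_lt s h]
      exact Submodule.subset_span ⟨_, rfl⟩
    · rw [ofFn_coeff_eq_zero_of_ge s h]
      exact zero_mem _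
  · rw [Submodule.span_le]
    rintro _ ⟨i, rfl⟩
    simpa using coeff_mem_coeffSpan (R := R) (ofFn n s) i

theorem coeffSpan_map_eq_one [IsBezout R] [IsDomain R] {v : R[X]} (hv : v.IsPrimitive) :
    coeffSpan R (v.map (algebraMap R A)) = 1 := by
  refine le_antisymm (coeffSpan_le.2 fun i ↦ ?_) (Submodule.one_le.2 ?_)
  · rw [coeff_map]
    exact Submodule.algebraMap_mem _
  · have h : (1 : R) ∈ v.contentIdeal := by
      rw [(isPrimitive_iff_contentIdeal_eq_top v).1 hv]
      trivial
    have h' : v.contentIdeal ≤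
        (coeffSpan R (v.map (algebraMap R A))).comap (Algebra.linearMap R A) := by
      rw [contentIdeal_def, Ideal.span, Submodule.span_le]
      intro c hc
      obtain ⟨i, -, rfl⟩ := mem_coeffs_iff.1 hc
      simpa using coeff_mem_coeffSpan (R := R) (v.map (algebraMap R A)) i
    simpa using h' h

end

section
open Polynomial

theorem exists_mul_eq_map_isPrimitive {K : Type*} [Field K] [CharZero K]
    [Algebra.IsAlgebraic ℤ K] {f : K[X]} (hf : f ≠ 0) :
    ∃ (g : K[X]) (v : ℤ[X]), v.IsPrimitive ∧ f * g = v.map (algebraMap ℤ K) := by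
  let := Polynomial.algebra ℤ K
  obtain ⟨v, hv, g, hg⟩ := (Algebra.IsAlgebraic.isAlgebraic (R := ℤ[X]) f).exists_nonzero_dvd
    (mem_nonZeroDivisors_of_ne_zero hf)
  replace hg : v.map (algebraMap ℤ K) = f * g := hg
  have hc : (algebraMap ℤ K v.content) ≠ 0 := by
    simpa [content_eq_zero_iff] using hv
  refine ⟨C (algebraMap ℤ K v.content)⁻¹ * g, v.primPart, isPrimitive_primPart v, ?_⟩
  rw [mul_left_comm, ← hg]
  nth_rw 2 [eq_C_content_mul_primPart v]
  rw [Polynomial.map_mul, map_C, ← mul_assoc, ← C_mul, inv_mul_cancel₀ hc, C_1, one_mul]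

theorem exists_one_mem_mul_pow_div_pow {K : Type*} [Field K] [CharZero K]
    [Algebra.IsAlgebraic ℤ K] {I : Submodule ℤ K} (hfg : I.FG) (hI : I ≠ ⊥) :
    ∃ N : ℕ, 1 ∈ I * (I ^ (N + 1) / I ^ (N + 2)) := by
  obtain ⟨f, rfl⟩ := exists_coeffSpan_eq hfg
  have hf : f ≠ 0 := by
    rintro rfl
    exact hI coeffSpan_zero
  obtain ⟨g, v, hv, hfgv⟩ := exists_mul_eq_map_isPrimitive hf
  refine ⟨g.natDegree, ?_⟩
  have h := coeffSpan_pow_mul_le (R := ℤ) (g.natDegree + 2) (f.natDegree + 1) f g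
    (degree_le_natDegree.trans_lt (by exact_mod_cast Nat.lt_succ_self _))
    (degree_le_natDegree.trans_lt (by exact_mod_cast (by omega)))
  rw [hfgv, coeffSpan_map_eq_one hv, mul_one, mul_comm] at h
  refine mul_le_mul_right (Submodule.le_div_iff_mul_le.2 h) _ (coeffSpan_mul_le f g ?_)
  rw [hfgv, coeffSpan_map_eq_one hv]
  exact Submodule.one_le.1 le_rfl

end

section
variable {k A : Type*} [Field k] [CommRing A] [Algebra k A]

theorem pow_eq_top_of_one_mem [FiniteDimensional k A] {W : Submodule k A} (h1 : (1 : A) ∈ W)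
    {N n : ℕ} (hN : W ^ N = ⊤) (hn : Module.finrank k A ≤ n + 1) : W ^ n = ⊤ := by
  rcases subsingleton_or_nontrivial A with _ | _
  · exact Subsingleton.elim _ _
  have hmono : Monotone (W ^ · : ℕ → Submodule k A) :=
    monotone_nat_of_le_succ fun j ↦ by
      rw [pow_succ]
      exact le_mul_of_one_le_right' (Submodule.one_le.2 h1)
  have key : ∀ j, W ^ j = ⊤ ∨ j + 1 ≤ Module.finrank k ↥(W ^ j) := by
    intro j
    induction j with
    | zero =>
      right
      rw [pow_zero, Submodule.one_eq_span, finrank_span_singleton one_ne_zero]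
    | succ j ih =>
      by_contra! hcon
      obtain ⟨h₁, h₂⟩ := hcon
      have hj : W ^ j ≤ W ^ (j + 1) := hmono j.le_succ
      have h₃ : W ^ j ≠ ⊤ := fun h ↦ h₁ (top_le_iff.1 (h ▸ hj))
      have h₄ := ih.resolve_left h₃
      have heq : W ^ j = W ^ (j + 1) := Submodule.eq_of_le_of_finrank_le hj (by omega)
      have hst : ∀ i, W ^ (j + i) = W ^ j := by
        intro i
        induction i with
        | zero => rfl
        | succ i ih => rw [← add_assoc, pow_succ, ih, ← pow_succ, ← heq]
      exact h₃ (top_le_iff.1 (hN ▸ hst N ▸ hmono (by simp)))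
  refine (key n).elim id fun h ↦ ?_
  exact Submodule.eq_top_of_finrank_eq (le_antisymm (Submodule.finrank_le _) (hn.trans h))

theorem exists_isUnit_mem_of_infinite [Infinite k] [FiniteDimensional k A] {V : Submodule k A}
    (hV : Ideal.span (V : Set A) = ⊤) : ∃ u ∈ V, IsUnit u := by
  classical
  have : IsArtinianRing A := IsArtinianRing.of_finite k A
  have hfin : {m : Ideal A | m.IsMaximal}.Finite := IsArtinianRing.setOfPred_isMaximal_finite A
  let s : Finset (Submodule k V) :=
    hfin.toFinset.image fun m ↦ (m.restrictScalars k).comap V.subtype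
  have hs : ⊤ ∉ s := by
    intro h
    obtain ⟨m, hm, hmt⟩ := Finset.mem_image.1 h
    have hm : m.IsMaximal := by simpa using hm
    refine hm.ne_top (top_le_iff.1 (hV ▸ Ideal.span_le.2 fun x hx ↦ ?_))
    have : (⟨x, hx⟩ : V) ∈ (m.restrictScalars k).comap V.subtype := hmt ▸ trivial
    simpa using this
  obtain ⟨u, hu⟩ := (Set.ne_univ_iff_exists_notMem _).1
    (Subspace.biUnion_ne_univ_of_top_notMem hs)
  refine ⟨u, u.2, by_contra fun hnu ↦ hu ?_⟩
  obtain ⟨m, hm, hum⟩ := exists_max_ideal_of_mem_nonunits hnu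
  simp only [Set.mem_iUnion]
  exact ⟨_, Finset.mem_image.2 ⟨m, by simpa using hm, rfl⟩, by simpa using hum⟩

theorem ideal_span_eq_top_of_pow_eq_top {V : Submodule k A} {N : ℕ} (hN : V ^ (N + 1) = ⊤) :
    Ideal.span (V : Set A) = ⊤ := by
  rw [Ideal.eq_top_iff_one]
  have h : (1 : A) ∈ V ^ N * V := by rw [← pow_succ, hN]; trivial
  have : V ^ N * V ≤ (Ideal.span (V : Set A)).restrictScalars k :=
    Submodule.mul_le.2 fun a _ b hb ↦ Ideal.mul_mem_left _ _ (Ideal.subset_span hb)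
  exact this h

theorem pow_eq_top_of_infinite [Infinite k] [FiniteDimensional k A] {V : Submodule k A} {N n : ℕ}
    (hN : V ^ (N + 1) = ⊤) (hn : Module.finrank k A ≤ n + 1) : V ^ n = ⊤ := by
  obtain ⟨u, huV, u, rfl⟩ := exists_isUnit_mem_of_infinite (ideal_span_eq_top_of_pow_eq_top hN)
  have hmul (v : Aˣ) : Submodule.span k {(v : A)} * ⊤ = ⊤ := by
    refine top_le_iff.1 fun x _ ↦ Submodule.mem_span_singleton_mul.2 ⟨↑v⁻¹ * x, trivial, by simp⟩
  have h := pow_eq_top_of_one_mem (W := Submodule.span k {((u⁻¹ : Aˣ) : A)} * V) (N := N + 1)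
    (Submodule.mem_span_singleton_mul.2 ⟨u, huV, by simp⟩)
    (by rw [mul_pow, hN, Submodule.span_pow, Set.singleton_pow,
      ← Units.val_pow_eq_pow_val, hmul]) hn
  rw [← hmul (u ^ n), ← h, mul_pow, ← mul_assoc, Submodule.span_pow, Submodule.span_mul_span,
    Set.singleton_pow, Set.singleton_mul_singleton]
  simp [← mul_pow, ← Submodule.one_eq_span]

open TensorProduct in
/-- If some power of a subspace of a finite-dimensional commutative algebra is everything, then so
is every power whose exponent is at least the dimension minus one. -/
theorem pow_eq_top_of_finrank_le [FiniteDimensional k A] {V : Submodule k A} {N n : ℕ}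
    (hN : V ^ (N + 1) = ⊤) (hn : Module.finrank k A ≤ n + 1) : V ^ n = ⊤ := by
  let k' := AlgebraicClosure k
  let ι : A →ₐ[k] k' ⊗[k] A := Algebra.TensorProduct.includeRight
  have hpow (j : ℕ) : (V.baseChange k') ^ j = (V ^ j).baseChange k' := by
    have hspan (P : Submodule k A) :
        P.baseChange k' = Submodule.span k' (P.map ι.toLinearMap : Set (k' ⊗[k] A)) :=
      Submodule.baseChange_eq_span k' P
    rw [hspan, hspan, Submodule.span_pow, Submodule.map_pow, Submodule.pow_eq_span_pow_set,
      Submodule.span_span_of_tower]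
  have h : (V.baseChange k') ^ n = ⊤ :=
    pow_eq_top_of_infinite (N := N) (by rw [hpow, hN, Submodule.baseChange_top])
      (by rwa [Module.finrank_baseChange])
  rw [hpow] at h
  by_contra hne
  obtain ⟨φ, hφ, hle⟩ := Submodule.exists_le_ker_of_lt_top _ (lt_top_iff_ne_top.2 hne)
  refine hφ (LinearMap.ext fun x ↦ ?_)
  have hker : (V ^ n).baseChange k' ≤ LinearMap.ker (φ.baseChange k') := by
    rw [Submodule.baseChange_eq_span, Submodule.span_le]
    rintro _ ⟨y, hy, rfl⟩
    simp [LinearMap.mem_ker.1 (hle hy)]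
  have hx : (1 : k') ⊗ₜ[k] φ x = 0 := by
    have : (1 : k') ⊗ₜ[k] x ∈ (V ^ n).baseChange k' := h ▸ trivial
    simpa using hker this
  simpa using congrArg (TensorProduct.rid k k') hx

end

theorem finrank_quotient_map_le {K : Type*} [Field K] [NumberField K] (B : Subalgebra ℤ K)
    [Module.Finite ℤ B] (m : Ideal ℤ) [m.IsMaximal] :
    Module.finrank (ℤ ⧸ m) (B ⧸ m.map (algebraMap ℤ B)) ≤ Module.finrank ℚ K := by
  let b := Module.finBasis ℤ B
  have hspan : Submodule.span (ℤ ⧸ m)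
      (Set.range (Ideal.Quotient.mkₐ ℤ (m.map (algebraMap ℤ B)) ∘ b)) = ⊤ := by
    rw [← Submodule.restrictScalars_eq_top_iff ℤ,
      Submodule.restrictScalars_span ℤ _ Ideal.Quotient.mk_surjective, Set.range_comp,
      ← AlgHom.coe_toLinearMap, ← Submodule.map_span, b.span_eq, Submodule.map_top,
      LinearMap.range_eq_top]
    exact Ideal.Quotient.mkₐ_surjective ℤ _
  have hindep : LinearIndependent ℚ (B.val ∘ b) := by
    rw [← LinearIndependent.iff_fractionRing ℤ ℚ]
    exact b.linearIndependent.map' B.val.toLinearMap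
      (LinearMap.ker_eq_bot.2 Subtype.val_injective)
  let _ : Field (ℤ ⧸ m) := Ideal.Quotient.field m
  calc _ = Module.finrank (ℤ ⧸ m) (⊤ : Submodule (ℤ ⧸ m) (B ⧸ m.map (algebraMap ℤ B))) :=
        finrank_top _ _ |>.symm
    _ ≤ Fintype.card (Fin (Module.finrank ℤ B)) := by
        rw [← hspan]
        exact finrank_range_le_card _
    _ ≤ _ := hindep.fintype_card_le_finrank

theorem exists_smul_mem_of_map_eq_top {R B : Type*} [CommRing R] [CommRing B] [Algebra R B]
    [Module.Finite R B] {m : Ideal R} {P : Submodule R B}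
    (hP : P.map (Ideal.Quotient.mkₐ R (m.map (algebraMap R B))).toLinearMap = ⊤) :
    ∃ r : R, r - 1 ∈ m ∧ ∀ b : B, r • b ∈ P := by
  obtain ⟨r, hr, hrP⟩ := Submodule.exists_sub_one_mem_and_smul_le_of_fg_of_le_sup (I := m) (N := P)
    (N' := ⊤) (P := ⊤) Module.Finite.fg_top le_rfl fun b _ ↦ by
      obtain ⟨y, hy, hyb⟩ : Ideal.Quotient.mkₐ R (m.map (algebraMap R B)) b ∈
        P.map (Ideal.Quotient.mkₐ R (m.map (algebraMap R B))).toLinearMap := hP ▸ trivial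
      rw [Ideal.smul_top_eq_map]
      refine Submodule.mem_sup.2 ⟨y, hy, b - y, ?_, by simp⟩
      exact Ideal.Quotient.eq.1 hyb.symm
  exact ⟨r, hr, fun b ↦ hrP (Submodule.smul_mem_pointwise_smul b r ⊤ trivial)⟩

/-- If `1 ∈ I * C`, then a single element of `C` suffices modulo finitely many maximal ideals. -/
theorem exists_mem_forall_mul_notMem {R K A : Type*} [CommRing R] [CommRing K] [Algebra R K]
    [CommRing A] [IsArtinianRing A] {B : Subalgebra R K} (ψ : B →+* A)
    (hψ : Function.Surjective ψ) {I C : Submodule R K} (h1 : 1 ∈ I * C)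
    (hle : I * C ≤ B.toSubmodule) (hBC : B.toSubmodule * C ≤ C) :
    ∃ c ∈ C, ∀ i : MaximalSpectrum A, ∃ b : B, (∃ x ∈ I, c * x = b) ∧ ψ b ∉ i.asIdeal := by
  classical
  let _ := Fintype.ofFinite (MaximalSpectrum A)
  have hlocal (i : MaximalSpectrum A) : ∃ c ∈ C, ∃ x ∈ I, ∃ b : B, c * x = b ∧ ψ b ∉ i.asIdeal := by
    by_contra! hcon
    let P : Submodule R K := ((i.asIdeal.comap ψ).restrictScalars R).map B.val.toLinearMap
    have hP : I * C ≤ P := Submodule.mul_le.2 fun x hx c hc ↦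
      ⟨⟨x * c, hle (Submodule.mul_mem_mul hx hc)⟩, hcon c hc x hx _ (mul_comm c x), rfl⟩
    obtain ⟨b, hb, hb1⟩ := hP h1
    obtain rfl : b = 1 := Subtype.ext hb1
    exact i.isMaximal.ne_top ((Ideal.eq_top_iff_one _).2 (by simpa using hb))
  choose c hc x hx b hcx hb using hlocal
  have hcoprime : Pairwise (Function.onFun IsCoprime (MaximalSpectrum.asIdeal (R := A))) :=
    fun i j hij ↦ Ideal.isCoprime_iff_sup_eq.2
      (i.isMaximal.coprime_of_ne j.isMaximal fun h ↦ hij (MaximalSpectrum.ext h))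
  have hidem (i : MaximalSpectrum A) : ∃ e : B, ∀ j : MaximalSpectrum A,
      ψ e - (if i = j then 1 else 0) ∈ j.asIdeal := by
    obtain ⟨a, ha⟩ := Ideal.exists_forall_sub_mem_ideal hcoprime fun j ↦ if i = j then 1 else 0
    obtain ⟨e, rfl⟩ := hψ a
    exact ⟨e, ha⟩
  choose e he using hidem
  refine ⟨∑ i, e i * c i, sum_mem fun i _ ↦ hBC (Submodule.mul_mem_mul (e i).2 (hc i)), fun i ↦ ?_⟩
  let b' (j : MaximalSpectrum A) : B :=
    ⟨c j * x i, mul_comm (x i) (c j) ▸ hle (Submodule.mul_mem_mul (hx i) (hc j))⟩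
  refine ⟨∑ j, e j * b' j, ⟨x i, hx i, ?_⟩, fun hmem ↦ hb i ?_⟩
  · simp [b', Finset.sum_mul, mul_assoc]
  · have hbi : b' i = b i := Subtype.ext (hcx i)
    rw [← Ideal.Quotient.eq_zero_iff_mem] at hmem ⊢
    have hmk (j) : Ideal.Quotient.mk i.asIdeal (ψ (e j)) = if j = i then 1 else 0 := by
      rw [Ideal.Quotient.eq.2 (he j i)]
      split_ifs <;> simp
    simpa [hmk, hbi] using hmem

/-- The multiplier ring `(P : P)` of a submodule, as a subalgebra. -/
def multiplierSubalgebra {R A : Type*} [CommRing R] [CommRing A] [Algebra R A]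
    (P : Submodule R A) : Subalgebra R A where
  __ := P / P
  mul_mem' {x y} hx hy := Submodule.mem_div_iff_forall_mul_mem.2 fun z hz ↦ by
    rw [mul_assoc]
    exact Submodule.mem_div_iff_forall_mul_mem.1 hx _
      (Submodule.mem_div_iff_forall_mul_mem.1 hy z hz)
  algebraMap_mem' r := Submodule.mem_div_iff_forall_mul_mem.2 fun z hz ↦ by
    rw [← Algebra.smul_def]
    exact P.smul_mem r hz

theorem div_self_fg {R K : Type*} [CommRing R] [IsNoetherianRing R] [Field K] [Algebra R K]
    {P : Submodule R K} (hfg : P.FG) (hP : P ≠ ⊥) : (P / P).FG := by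
  obtain ⟨x, hx, hx0⟩ := P.exists_mem_ne_zero_of_ne_bot hP
  refine Submodule.FG.of_le ((Submodule.fg_span_singleton x⁻¹).mul hfg) fun y hy ↦ ?_
  exact Submodule.mem_span_singleton_mul.2 ⟨y * x, Submodule.mem_div_iff_forall_mul_mem.1 hy x hx,
    by field_simp⟩

section
variable {R A : Type*} [CommRing R] [CommRing A] [Algebra R A]

theorem div_mul_le (I J : Submodule R A) : I / J * J ≤ I := Submodule.le_div_iff_mul_le.1 le_rfl

theorem mul_pow_div_pow_succ_le (I : Submodule R A) (n : ℕ) :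
    I * (I ^ n / I ^ (n + 1)) ≤ I ^ n / I ^ n :=
  Submodule.le_div_iff_mul_le.2 <| by
    rw [mul_right_comm, ← pow_succ', mul_comm]
    exact div_mul_le _ _

theorem pow_div_pow_le_succ (I : Submodule R A) (n : ℕ) :
    I ^ n / I ^ n ≤ I ^ (n + 1) / I ^ (n + 1) :=
  Submodule.le_div_iff_mul_le.2 <| by
    rw [pow_succ, ← mul_assoc]
    exact mul_le_mul_left (div_mul_le _ _) _

theorem pow_div_pow_succ_le_of_one_mem {I : Submodule R A} {n : ℕ}
    (h : 1 ∈ I * (I ^ n / I ^ (n + 1))) : I ^ (n + 1) / I ^ (n + 1) ≤ I ^ n / I ^ n := by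
  rw [Submodule.le_div_iff_mul_le]
  set B := I ^ (n + 1) / I ^ (n + 1)
  set C := I ^ n / I ^ (n + 1)
  have hB : B * I ^ (n + 1) ≤ I ^ (n + 1) := div_mul_le _ _
  have hC : C * I ^ (n + 1) ≤ I ^ n := div_mul_le _ _
  calc B * I ^ n ≤ B * I ^ n * (I * C) := le_mul_of_one_le_right' (Submodule.one_le.2 h)
    _ = C * (B * I ^ (n + 1)) := by ring
    _ ≤ I ^ n := by grw [hB, hC]

end

theorem isArtinianRing_of_isScalarTower_quotient {R A : Type*} [CommRing R] [CommRing A]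
    [Algebra R A] (m : Ideal R) [m.IsMaximal] [Algebra (R ⧸ m) A] [IsScalarTower R (R ⧸ m) A]
    [Module.Finite R A] : IsArtinianRing A := by
  let _ : Field (R ⧸ m) := Ideal.Quotient.field m
  have : Module.Finite (R ⧸ m) A := Module.Finite.of_restrictScalars_finite R _ A
  exact IsArtinianRing.of_finite (R ⧸ m) A

theorem pow_eq_top_of_finrank_quotient_le {R A : Type*} [CommRing R] [CommRing A]
    [Algebra R A] (m : Ideal R) [m.IsMaximal] [Algebra (R ⧸ m) A] [IsScalarTower R (R ⧸ m) A]
    [Module.Finite R A] {V : Submodule R A} {N n : ℕ} (hN : V ^ (N + 1) = ⊤)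
    (hn : Module.finrank (R ⧸ m) A ≤ n + 1) : V ^ n = ⊤ := by
  let _ : Field (R ⧸ m) := Ideal.Quotient.field m
  have : Module.Finite (R ⧸ m) A := Module.Finite.of_restrictScalars_finite R _ A
  have hpow (j : ℕ) : ((Submodule.span (R ⧸ m) (V : Set A)) ^ j).restrictScalars R = V ^ j := by
    rw [Submodule.span_pow, Submodule.restrictScalars_span R _ Ideal.Quotient.mk_surjective,
      ← Submodule.pow_eq_span_pow_set]
  rw [← hpow, Submodule.restrictScalars_eq_top_iff] at hN ⊢
  exact pow_eq_top_of_finrank_le hN hn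

theorem top_pow_succ {R A : Type*} [CommRing R] [CommRing A] [Algebra R A] (n : ℕ) :
    (⊤ : Submodule R A) ^ (n + 1) = ⊤ := by
  refine eq_top_iff.2 fun x _ ↦ ?_
  rw [pow_succ]
  simpa using Submodule.mul_mem_mul (Submodule.one_le.1 (one_le_pow_of_one_le' le_top n))
    (Submodule.mem_top (R := R) (x := x))

theorem top_mul_eq_top_of_forall_notMem {R A : Type*} [CommRing R] [CommRing A] [Algebra R A]
    {V : Submodule R A} (hV : ∀ i : MaximalSpectrum A, ∃ v ∈ V, v ∉ i.asIdeal) : ⊤ * V = ⊤ := by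
  have h1 : (1 : A) ∈ Ideal.span (V : Set A) := by
    rw [← Ideal.eq_top_iff_one]
    by_contra h
    obtain ⟨i, hi, hle⟩ := Ideal.exists_le_maximal _ h
    obtain ⟨v, hv, hvi⟩ := hV ⟨i, hi⟩
    exact hvi (hle (Ideal.subset_span hv))
  have hle : ∀ x ∈ Ideal.span (V : Set A), x ∈ (⊤ : Submodule R A) * V := fun x hx ↦ by
    induction hx using Submodule.span_induction with
    | mem x hx => simpa using Submodule.mul_mem_mul (Submodule.mem_top (x := 1)) hx
    | zero => exact zero_mem _
    | add x y _ _ hx hy => exact add_mem hx hy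
    | smul a x _ hx =>
      have h := Submodule.mul_mem_mul (Submodule.mem_top (R := R) (x := a)) hx
      rw [← mul_assoc] at h
      exact mul_le_mul_left le_top V h
  refine eq_top_iff.2 fun x _ ↦ hle x ?_
  simpa using Ideal.mul_mem_left _ x h1

theorem map_pow_succ_eq_top {R B A : Type*} [CommRing R] [CommRing B] [CommRing A] [Algebra R B]
    [Algebra R A] {ψ : B →ₐ[R] A} (hψ : Function.Surjective ψ) {J : Submodule R B} {n : ℕ}
    (hspan : ⊤ * J.map ψ.toLinearMap = ⊤) (hstable : ⊤ * J ^ (n + 1) ≤ J ^ (n + 1)) :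
    (J ^ (n + 1)).map ψ.toLinearMap = ⊤ := by
  have hψtop : (⊤ : Submodule R B).map ψ.toLinearMap = ⊤ := by
    rw [Submodule.map_top, LinearMap.range_eq_top]
    exact hψ
  rw [eq_top_iff]
  calc ⊤ = (⊤ * J.map ψ.toLinearMap) ^ (n + 1) := by rw [hspan, top_pow_succ]
    _ = (⊤ * J ^ (n + 1)).map ψ.toLinearMap := by
      rw [mul_pow, top_pow_succ, Submodule.map_mul, hψtop, Submodule.map_pow]
    _ ≤ _ := Submodule.map_mono hstable

theorem exists_sub_one_mem_and_mem_mul_pow_div_pow {K : Type*} [Field K] [NumberField K]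
    {I : Submodule ℤ K} (hfg : I.FG) (hI : I ≠ ⊥) {n : ℕ} (hn : Module.finrank ℚ K ≤ n + 1)
    (m : Ideal ℤ) [hm : m.IsMaximal] :
    ∃ r : ℤ, r - 1 ∈ m ∧ algebraMap ℤ K r ∈ I * (I ^ n / I ^ (n + 1)) := by
  have : Algebra.IsAlgebraic ℤ K := by
    exact (IsFractionRing.comap_isAlgebraic_iff (A := ℤ) (K := ℚ) (C := K)).2 inferInstance
  obtain ⟨N, h1⟩ := exists_one_mem_mul_pow_div_pow hfg hI
  set M := N + 1
  set C := I ^ M / I ^ (M + 1)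
  obtain ⟨B, hB⟩ : ∃ B : Subalgebra ℤ K, B.toSubmodule = I ^ M / I ^ M :=
    ⟨multiplierSubalgebra (I ^ M), rfl⟩
  have hIC : I * C ≤ B.toSubmodule := hB ▸ mul_pow_div_pow_succ_le I M
  have hBI : B.toSubmodule * I ^ M ≤ I ^ M := hB ▸ div_mul_le _ _
  have hBC : B.toSubmodule * C ≤ C := Submodule.le_div_iff_mul_le.2 <| by
    calc B.toSubmodule * C * I ^ (M + 1) = B.toSubmodule * (C * I ^ (M + 1)) := mul_assoc _ _ _
      _ ≤ I ^ M := by grw [show C * I ^ (M + 1) ≤ I ^ M from div_mul_le _ _, hBI]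
  have : Module.Finite ℤ B := Module.Finite.iff_fg.2
    (hB ▸ div_self_fg (hfg.pow M) (pow_ne_zero M hI))
  have : IsArtinianRing (B ⧸ m.map (algebraMap ℤ B)) := isArtinianRing_of_isScalarTower_quotient m
  let ψ : B →ₐ[ℤ] B ⧸ m.map (algebraMap ℤ B) := Ideal.Quotient.mkₐ ℤ (m.map (algebraMap ℤ B))
  have hψ : Function.Surjective ψ := Ideal.Quotient.mkₐ_surjective ℤ _
  obtain ⟨c, hcC, hc⟩ := exists_mem_forall_mul_notMem ψ.toRingHom hψ h1 hIC hBC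
  let P := Submodule.span ℤ {c}
  have hPC : P ≤ C := (Submodule.span_singleton_le_iff_mem _ _).2 hcC
  have hJB : P * I ≤ B.toSubmodule := by grw [hPC, mul_comm, hIC]
  let J : Submodule ℤ B := (P * I).comap B.val.toLinearMap
  have hJ : J.map B.val.toLinearMap = P * I := by
    rw [Submodule.map_comap_eq, inf_eq_right]
    exact fun x hx ↦ ⟨⟨x, hJB hx⟩, rfl⟩
  have hval : (⊤ : Submodule ℤ B).map B.val.toLinearMap = B.toSubmodule := by
    ext; simp
  have hJpow (j : ℕ) : (J ^ j).map B.val.toLinearMap = P ^ j * I ^ j := by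
    rw [Submodule.map_pow, hJ, mul_pow]
  have hψtop : (⊤ : Submodule ℤ B).map ψ.toLinearMap = ⊤ := by
    rw [Submodule.map_top, LinearMap.range_eq_top]
    exact hψ
  have hspan : ⊤ * J.map ψ.toLinearMap = ⊤ := by
    refine top_mul_eq_top_of_forall_notMem fun i ↦ ?_
    obtain ⟨b, ⟨x, hx, hxb⟩, hbi⟩ := hc i
    refine ⟨ψ b, ⟨b, ?_, rfl⟩, hbi⟩
    change (b : K) ∈ P * I
    exact hxb ▸ Submodule.mul_mem_mul (Submodule.mem_span_singleton_self c) hx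
  have hstable : ⊤ * J ^ M ≤ J ^ M := by
    rw [← Submodule.map_le_map_iff_of_injective (f := B.val.toLinearMap) Subtype.val_injective,
      Submodule.map_mul, hval, hJpow]
    calc B.toSubmodule * (P ^ M * I ^ M) = P ^ M * (B.toSubmodule * I ^ M) := by ring
      _ ≤ _ := by grw [hBI]
  have hJM : (J.map ψ.toLinearMap) ^ M = ⊤ := by
    rw [← Submodule.map_pow]
    exact map_pow_succ_eq_top hψ hspan hstable
  have hJn : (J ^ n).map ψ.toLinearMap = ⊤ := by
    rw [Submodule.map_pow]
    exact pow_eq_top_of_finrank_quotient_le m hJM ((finrank_quotient_map_le B m).trans hn)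
  obtain ⟨r, hr, hrJ⟩ := exists_smul_mem_of_map_eq_top hJn
  obtain ⟨s, hs, hsJ⟩ := exists_smul_mem_of_map_eq_top (P := ⊤ * J) (m := m) (by
    rw [← hspan, Submodule.map_mul, ← hψtop])
  have hs1 : algebraMap ℤ K s ∈ B.toSubmodule * (P * I) := by
    rw [← hJ, ← hval, ← Submodule.map_mul]
    exact ⟨_, hsJ 1, by simp⟩
  have hrB : Submodule.span ℤ {algebraMap ℤ K r} * B.toSubmodule ≤ P ^ n * I ^ n := by
    intro x hx
    obtain ⟨b, hb, rfl⟩ := Submodule.mem_span_singleton_mul.1 hx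
    rw [← hJpow]
    exact ⟨_, hrJ ⟨b, hb⟩, by simp⟩
  have hc0 : c ≠ 0 := by
    rintro rfl
    have : s = 0 := by simpa [P] using hs1
    refine hm.ne_top ((Ideal.eq_top_iff_one _).2 ?_)
    simpa [this] using hs
  have hP : Submodule.span ℤ {c⁻¹} * P = 1 := by
    rw [Submodule.span_mul_span, Set.singleton_mul_singleton, inv_mul_cancel₀ hc0,
      Submodule.one_eq_span]
  set Q := Submodule.span ℤ {algebraMap ℤ K r}
  have hE : Q * P * B.toSubmodule ≤ I ^ n / I ^ (n + 1) := Submodule.le_div_iff_mul_le.2 <| by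
    have hJB' : B.toSubmodule * (P * I) ^ (n + 1) ≤ B.toSubmodule := by
      rw [← hJ, ← hval, ← Submodule.map_pow, ← Submodule.map_mul]
      exact Submodule.map_mono le_top
    calc Q * P * B.toSubmodule * I ^ (n + 1)
        = (Submodule.span ℤ {c⁻¹} * P) ^ n * (Q * P * B.toSubmodule * I ^ (n + 1)) := by
          rw [hP, one_pow, one_mul]
      _ = Submodule.span ℤ {c⁻¹} ^ n * (Q * (B.toSubmodule * (P * I) ^ (n + 1))) := by ring
      _ ≤ Submodule.span ℤ {c⁻¹} ^ n * (P ^ n * I ^ n) := by grw [hJB', hrB]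
      _ = (Submodule.span ℤ {c⁻¹} * P) ^ n * I ^ n := by ring
      _ = I ^ n := by rw [hP, one_pow, one_mul]
  refine ⟨r * s, ?_, ?_⟩
  · have : r * s - 1 = r * (s - 1) + (r - 1) := by ring
    rw [this]
    exact add_mem (m.mul_mem_left r hs) hr
  · have hle : Q * (B.toSubmodule * (P * I)) ≤ I * (I ^ n / I ^ (n + 1)) := by
      grw [← hE]
      exact le_of_eq (by ring)
    rw [map_mul]
    exact hle (Submodule.mul_mem_mul (Submodule.mem_span_singleton_self _) hs1)

theorem one_mem_mul_pow_div_pow_int {K : Type*} [Field K] [NumberField K] {I : Submodule ℤ K}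
    (hfg : I.FG) (hI : I ≠ ⊥) {n : ℕ} (hn : Module.finrank ℚ K ≤ n + 1) :
    1 ∈ I * (I ^ n / I ^ (n + 1)) := by
  let a : Ideal ℤ := (I * (I ^ n / I ^ (n + 1))).comap (Algebra.linearMap ℤ K)
  have ha : a = ⊤ := by
    by_contra h
    obtain ⟨m, hm, hle⟩ := Ideal.exists_le_maximal _ h
    obtain ⟨r, hr, hrI⟩ := exists_sub_one_mem_and_mem_mul_pow_div_pow hfg hI hn m
    have hrm : r ∈ m := hle hrI
    refine hm.ne_top ((Ideal.eq_top_iff_one _).2 ?_)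
    simpa using sub_mem hrm hr
  have h1 : (1 : ℤ) ∈ a := ha ▸ Submodule.mem_top
  simpa [a] using h1

theorem one_mem_mul_pow_div_pow {K : Type*} [Field K] [NumberField K] {R : Type*} [CommRing R]
    [Algebra R K] {I : Submodule R K} (hfg : I.FG) (hI : I ≠ ⊥) {n : ℕ}
    (hn : Module.finrank ℚ K ≤ n + 1) : 1 ∈ I * (I ^ n / I ^ (n + 1)) := by
  obtain ⟨s, rfl⟩ := hfg
  let I₀ := Submodule.span ℤ (s : Set K)
  have hI₀ : I₀ ≠ ⊥ := fun h ↦ hI <| by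
    rw [Submodule.span_eq_bot] at h ⊢
    exact h
  have hspan (j : ℕ) :
      Submodule.span R (s : Set K) ^ j = Submodule.span R (I₀ ^ j : Submodule ℤ K) := by
    rw [Submodule.span_pow, Submodule.span_pow, Submodule.span_span_of_tower]
  have h1 := one_mem_mul_pow_div_pow_int (Submodule.fg_span s.finite_toSet) hI₀ hn
  refine Submodule.mul_induction_on h1 (fun x hx y hy ↦ Submodule.mul_mem_mul ?_ ?_)
    fun _ _ ↦ add_mem
  · exact Submodule.span_subset_span ℤ R _ hx
  · rw [Submodule.mem_div_iff_forall_mul_mem] at hy ⊢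
    intro z hz
    rw [hspan] at hz ⊢
    induction hz using Submodule.span_induction with
    | mem z hz => exact Submodule.subset_span (hy z hz)
    | zero => simp
    | add z w _ _ hz hw => simpa [mul_add] using add_mem hz hw
    | smul a z _ hz => simpa using Submodule.smul_mem _ a hz

section
variable {K : Type*} [Field K] {R : Subring K} (T : Subring K) (I : Submodule R K)

theorem exists_span_mul_eq_one {n : ℕ} (h1 : 1 ∈ I * (I ^ n / I ^ (n + 1)))
    (hT : ((I ^ n / I ^ n : Submodule R K) : Set K) ⊆ T) :
    ∃ J : Submodule T K, Submodule.span T (I : Set K) * J = 1 := by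
  refine ⟨Submodule.span T ((I ^ n / I ^ (n + 1) : Submodule R K) : Set K), le_antisymm ?_ ?_⟩
  · rw [Submodule.span_mul_span, Submodule.span_le]
    rintro _ ⟨x, hx, y, hy, rfl⟩
    exact Submodule.mem_one.2
      ⟨⟨x * y, hT (mul_pow_div_pow_succ_le I n (Submodule.mul_mem_mul hx hy))⟩, rfl⟩
  · rw [Submodule.one_le]
    exact Submodule.mul_induction_on h1 (fun x hx y hy ↦ Submodule.mul_mem_mul
      (Submodule.subset_span hx) (Submodule.subset_span hy)) fun _ _ ↦ add_mem

theorem pow_succ_subset_span_pow_succ (k : ℕ) :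
    ((I ^ (k + 1) : Submodule R K) : Set K) ⊆
      (Submodule.span T (I : Set K) ^ (k + 1) : Submodule T K) := by
  induction k with
  | zero => simp [Submodule.subset_span]
  | succ k ih =>
    intro x hx
    rw [SetLike.mem_coe, pow_succ] at hx ⊢
    exact Submodule.mul_induction_on hx (fun x hx y hy ↦ Submodule.mul_mem_mul
      (ih hx) (Submodule.subset_span hy)) fun _ _ ↦ add_mem

theorem pow_div_pow_subset_of_span_mul_eq_one {J : Submodule T K}
    (hJ : Submodule.span T (I : Set K) * J = 1) (k : ℕ) :
    ((I ^ k / I ^ k : Submodule R K) : Set K) ⊆ T := by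
  intro x hx
  replace hx := Submodule.mem_div_iff_forall_mul_mem.1 (pow_div_pow_le_succ I k hx)
  set L := Submodule.span T (I : Set K)
  have hspan : L ^ (k + 1) = Submodule.span T ((I ^ (k + 1) : Submodule R K) : Set K) := by
    refine le_antisymm ?_ (Submodule.span_le.2 (pow_succ_subset_span_pow_succ T I k))
    rw [Submodule.span_pow]
    exact Submodule.span_mono (Submodule.pow_subset_pow _)
  have hxL : Submodule.span T {x} * L ^ (k + 1) ≤ L ^ (k + 1) := by
    nth_rw 1 [hspan]
    rw [Submodule.span_mul_span, Submodule.span_le]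
    rintro _ ⟨_, rfl, y, hy, rfl⟩
    exact pow_succ_subset_span_pow_succ T I k (hx y hy)
  have hle : Submodule.span T {x} ≤ 1 := by
    calc _ = Submodule.span T {x} * L ^ (k + 1) * J ^ (k + 1) := by
          rw [mul_assoc, ← mul_pow, hJ, one_pow, mul_one]
      _ ≤ L ^ (k + 1) * J ^ (k + 1) := by grw [hxL]
      _ = 1 := by rw [← mul_pow, hJ, one_pow]
  obtain ⟨t, rfl⟩ := Submodule.mem_one.1 (hle (Submodule.mem_span_singleton_self x))
  exact t.2

end

/-- (Dade–Taussky–Zassenhaus) Let `K` be a number field, `R ⊆ K` a subring, and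
`I ⊆ K` a finitely generated nonzero `R`-submodule. Then the blowup
`Bl_K(I) = ⋃_{k ≥ 0} (Iᵏ : Iᵏ)_K` equals `(Iⁿ : Iⁿ)_K` for every `n ≥ [K:ℚ] − 1`,
and for any subring `T ⊆ K` we have `Bl_K(I) ⊆ T` iff the `T`-submodule `TI` of
`K` is an invertible ideal of `T` within `K` (i.e. `(TI)·J = T` for some
`T`-submodule `J` of `K`).  Here `(I : J)_K = {x ∈ K : xJ ⊆ I}` is realized by
`Submodule.div`. -/
theorem stmt_6 {K : Type*} [Field K] [NumberField K] (R : Subring K)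
    (I : Submodule ↥R K) (hfg : I.FG) (hI : I ≠ ⊥) :
    (∀ n : ℕ, Module.finrank ℚ K ≤ n + 1 →
      (⋃ k : ℕ, ((I ^ k / I ^ k : Submodule ↥R K) : Set K)) =
        ((I ^ n / I ^ n : Submodule ↥R K) : Set K)) ∧
    (∀ T : Subring K,
      (⋃ k : ℕ, ((I ^ k / I ^ k : Submodule ↥R K) : Set K)) ⊆ (T : Set K) ↔
        ∃ J : Submodule ↥T K, Submodule.span ↥T (I : Set K) * J = 1) := by
  have hle {n : ℕ} (hn : Module.finrank ℚ K ≤ n + 1) (k : ℕ) : I ^ k / I ^ k ≤ I ^ n / I ^ n := by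
    have hmono : Monotone fun j ↦ I ^ j / I ^ j := monotone_nat_of_le_succ (pow_div_pow_le_succ I)
    rcases le_total k n with hkn | hkn
    · exact hmono hkn
    · induction k, hkn using Nat.le_induction with
      | base => exact le_rfl
      | succ k hk ih =>
        exact (pow_div_pow_succ_le_of_one_mem (one_mem_mul_pow_div_pow hfg hI (by omega))).trans ih
  refine ⟨fun n hn ↦ (Set.iUnion_subset fun k ↦ hle hn k).antisymm
    (Set.subset_iUnion (fun k ↦ ((I ^ k / I ^ k : Submodule R K) : Set K)) n), fun T ↦ ⟨fun hT ↦ ?_,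
    fun ⟨J, hJ⟩ ↦ Set.iUnion_subset (pow_div_pow_subset_of_span_mul_eq_one T I hJ)⟩⟩
  exact exists_span_mul_eq_one T I
    (one_mem_mul_pow_div_pow hfg hI (Nat.le_succ (Module.finrank ℚ K)))
    ((Set.subset_iUnion (fun k ↦ ((I ^ k / I ^ k : Submodule R K) : Set K)) _).trans hT)
end

section
/- Let b be a positive odd integer and let B be a free ℤ/bℤ-module of finite rank. Then for every ℤ/bℤ-module automorphism σ of B, the sign of σ as a permutation of the underlying finite set of B equals the Jacobi symbol (d/b), where d ∈ ℤ is any integer whose residue class modulo b is det(σ). -/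
open Equiv Equiv.Perm Matrix

theorem Int.units_pow_of_odd (u : ℤˣ) {k : ℕ} (hk : Odd k) : u ^ k = u := by
  rw [Int.units_pow_eq_pow_mod_two, Nat.odd_iff.mp hk, pow_one]

theorem Equiv.Perm.sign_eq_one_of_pow_eq_one {α : Type*} [Fintype α] [DecidableEq α]
    {σ : Perm α} {k : ℕ} (hk : Odd k) (h : σ ^ k = 1) : sign σ = 1 := by
  rw [← Int.units_pow_of_odd (sign σ) hk, ← map_pow, h, map_one]

theorem Equiv.Perm.sign_addLeft_of_odd_card {G : Type*} [AddGroup G] [Fintype G] [DecidableEq G]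
    (hG : Odd (Fintype.card G)) (t : G) : sign (Equiv.addLeft t) = 1 := by
  refine sign_eq_one_of_pow_eq_one hG ?_
  rw [Equiv.nsmul_addLeft, card_nsmul_eq_zero, Equiv.addLeft_zero]

/-- Multiplicativity of the sign of additive permutations along a short exact sequence
`0 → C → B → Q → 0` of abelian groups with `C` and `Q` of odd order. -/
theorem Equiv.Perm.sign_eq_mul_of_exact {C B Q : Type*} [AddCommGroup C] [AddCommGroup B]
    [AddCommGroup Q] [Fintype C] [Fintype B] [Fintype Q] [DecidableEq C] [DecidableEq B]
    [DecidableEq Q] (f : C →+ B) (g : B →+ Q) (hf : Function.Injective f)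
    (hg : Function.Surjective g) (hfg : ∀ x, g x = 0 ↔ ∃ c, f c = x)
    (γ : Perm C) (β : Perm B) (κ : Perm Q) (hβ : ∀ x y, β (x + y) = β x + β y)
    (hγ : ∀ c, β (f c) = f (γ c)) (hκ : ∀ x, g (β x) = κ (g x))
    (hC : Odd (Fintype.card C)) (hQ : Odd (Fintype.card Q)) :
    sign β = sign γ * sign κ := by
  obtain ⟨s, hs⟩ := hg.hasRightInverse
  have hgf (c : C) : g (f c) = 0 := (hfg _).mpr ⟨c, rfl⟩
  have he : Function.Bijective (fun x : Q × C => s x.1 + f x.2) := by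
    constructor
    · rintro ⟨q, c⟩ ⟨q', c'⟩ h
      have hq : q = q' := by simpa [hgf, hs q, hs q'] using congrArg g h
      subst hq
      simpa using hf (add_left_cancel h)
    · intro x
      obtain ⟨c, hc⟩ := (hfg (x - s (g x))).mp (by simp [hs (g x)])
      exact ⟨(g x, c), by simp [hc]⟩
  have ht (q : Q) : ∃ t, f t = β (s q) - s (κ q) := by
    rw [← hfg, map_sub, hκ, hs q, hs (κ q), sub_self]
  choose t ht using ht
  let τ : Perm (Q × C) :=
    Equiv.prodCongrLeft (fun _ : C => κ) * Equiv.prodCongrRight (fun q => Equiv.addLeft (t q) * γ)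
  have hτ : sign τ = sign β := by
    refine sign_eq_sign_of_equiv τ β (Equiv.ofBijective _ he) ?_
    rintro ⟨q, c⟩
    simp only [τ, Perm.mul_apply, prodCongrRight_apply, prodCongrLeft_apply, ofBijective_apply,
      coe_addLeft, map_add, hβ, hγ, ht]
    abel
  rw [← hτ, sign_mul, sign_prodCongrLeft, sign_prodCongrRight]
  simp [sign_addLeft_of_odd_card hC, Int.units_pow_of_odd _ hC, Int.units_pow_of_odd _ hQ, mul_comm]

theorem Matrix.exists_perm_mulVec {n R : Type*} [Fintype n] [DecidableEq n] [CommRing R]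
    {M : Matrix n n R} (hM : IsUnit M.det) : ∃ σ : Perm (n → R), ∀ v, σ v = M *ᵥ v := by
  refine ⟨⟨fun v => M *ᵥ v, fun v => M⁻¹ *ᵥ v, fun v => ?_, fun v => ?_⟩, fun v => rfl⟩
  · simp [Matrix.mulVec_mulVec, Matrix.nonsing_inv_mul _ hM]
  · simp [Matrix.mulVec_mulVec, Matrix.mul_nonsing_inv _ hM]

section FiniteField

variable {F : Type*} [Field F] [Fintype F] [DecidableEq F]

/-- Zolotarev's lemma for a finite field of odd characteristic. -/
theorem FiniteField.sign_toPerm_units (hF : ringChar F ≠ 2) (u : Fˣ) :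
    ((sign (MulAction.toPerm u : Perm F) : ℤˣ) : ℤ) = quadraticChar F u := by
  obtain ⟨g, hg⟩ := IsCyclic.exists_generator (α := Fˣ)
  have hχ : quadraticChar F g = -1 := by
    rw [quadraticChar_neg_one_iff_not_isSquare]
    intro hsq
    obtain ⟨a, ha⟩ := FiniteField.exists_nonsquare hF
    have ha0 : a ≠ 0 := by rintro rfl; exact ha (IsSquare.zero)
    obtain ⟨k, hk⟩ := hg (Units.mk0 a ha0)
    apply ha
    have : a = (g : F) ^ k := by
      simpa using (congrArg (Units.val) hk).symm
    rw [this]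
    exact hsq.zpow k
  have hg1 : (g : F) ≠ 1 := by
    intro h
    rw [h] at hχ
    simp at hχ
  have hfix (x : F) : (MulAction.toPerm g : Perm F) x ≠ x ↔ x ≠ 0 := by
    simp [Units.smul_def, mul_left_eq_self₀, hg1]
  have hcycle : (MulAction.toPerm g : Perm F).IsCycle := by
    refine ⟨1, (hfix 1).mpr one_ne_zero, fun y hy => ?_⟩
    obtain ⟨k, hk⟩ := hg (Units.mk0 y ((hfix y).mp hy))
    refine ⟨k, ?_⟩
    have h := map_zpow (MulAction.toPermHom Fˣ F) g k
    simp only [MulAction.toPermHom_apply] at h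
    rw [← h]
    simp only at hk
    simp [hk, Units.smul_def]
  have hsign : sign (MulAction.toPerm g : Perm F) = -1 := by
    rw [hcycle.sign]
    have hsupp : (MulAction.toPerm g : Perm F).support = Finset.univ.erase 0 := by
      ext x
      simp only [mem_support, hfix, Finset.mem_erase, Finset.mem_univ, and_true]
    have heven : Even (Fintype.card F - 1) :=
      (Nat.odd_iff.mpr (FiniteField.odd_card_of_char_ne_two hF)).tsub_odd odd_one
    rw [hsupp, Finset.card_erase_of_mem (Finset.mem_univ _), Finset.card_univ, heven.neg_one_pow]
  obtain ⟨k, rfl⟩ := hg u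
  have h := map_zpow (sign.comp (MulAction.toPermHom Fˣ F)) g k
  simp only [MonoidHom.comp_apply, MulAction.toPermHom_apply, hsign] at h
  have h2 := map_zpow (quadraticChar F).toUnitHom g k
  have h3 : (quadraticChar F).toUnitHom g = -1 := by
    ext
    simp [hχ]
  rw [h3] at h2
  rw [← MulChar.coe_toUnitHom]
  simp only
  rw [h, h2]

theorem FiniteField.sign_diagonal (hF : ringChar F ≠ 2) {n : Type*} [Fintype n] [DecidableEq n]
    (D : n → Fˣ) :
    sign (MulAction.toPerm D : Perm (n → F)) = ∏ i, sign (MulAction.toPerm (D i) : Perm F) := by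
  have hcard : Odd (Fintype.card F) := Nat.odd_iff.mpr (FiniteField.odd_card_of_char_ne_two hF)
  let φ : (n → Fˣ) →* ℤˣ := sign.comp (MulAction.toPermHom (n → Fˣ) (n → F))
  let ψ : (n → Fˣ) →* ℤˣ :=
    ∏ i, (sign.comp (MulAction.toPermHom Fˣ F)).comp (Pi.evalMonoidHom (fun _ : n => Fˣ) i)
  have key : φ = ψ := by
    refine MonoidHom.functions_ext _ _ _ fun i u => ?_
    have hψ : ψ (Pi.mulSingle i u) = sign (MulAction.toPerm u : Perm F) := by
      simp only [ψ, MonoidHom.finsetProd_apply, MonoidHom.comp_apply, Pi.evalMonoidHom_apply]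
      rw [Finset.prod_eq_single i]
      · simp
      · intro j _ hj
        rw [Pi.mulSingle_eq_of_ne hj, map_one, map_one]
      · simp
    rw [hψ]
    have h := sign_eq_mul_of_exact (AddMonoidHom.single (fun _ : n => F) i)
      (AddMonoidHom.pi (fun j : {j // j ≠ i} => Pi.evalAddMonoidHom (fun _ : n => F) j))
      (Pi.single_injective (M := fun _ : n => F) i) (fun y => ⟨fun j => if h : j ≠ i then y ⟨j, h⟩ else 0, by
        ext j; simp [j.2]⟩)
      (fun x => by
        constructor
        · intro hx
          refine ⟨x i, ?_⟩
          ext j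
          by_cases hj : j = i
          · subst hj; simp
          · simpa [hj] using (congrFun hx ⟨j, hj⟩).symm
        · rintro ⟨c, rfl⟩
          ext j
          simp [j.2])
      (MulAction.toPerm u) (MulAction.toPerm (Pi.mulSingle i u : n → Fˣ)) 1
      (fun x y => smul_add (Pi.mulSingle i u : n → Fˣ) x y)
      (fun c => by
        ext j
        by_cases hj : j = i
        · subst hj; simp
        · simp [hj])
      (fun x => by
        ext j
        simp [j.2])
      hcard (by simpa using hcard.pow)
    simpa [φ] using h
  simpa [φ, ψ] using DFunLike.congr_fun key D

theorem FiniteField.sign_mulVec (hF : ringChar F ≠ 2) {n : Type*} [Fintype n] [DecidableEq n]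
    (M : Matrix n n F) (hM : M.det ≠ 0) (σ : Perm (n → F)) (hσ : ∀ v, σ v = M *ᵥ v) :
    ((sign σ : ℤˣ) : ℤ) = quadraticChar F M.det := by
  revert σ
  refine Matrix.diagonal_transvection_induction_of_det_ne_zero
    (fun M => ∀ σ : Perm (n → F), (∀ v, σ v = M *ᵥ v) →
      ((sign σ : ℤˣ) : ℤ) = quadraticChar F M.det) M hM ?_ ?_ ?_
  · intro D hD σ hσ
    rw [det_diagonal, Finset.prod_ne_zero_iff] at hD
    have h : σ = MulAction.toPerm (fun i => Units.mk0 (D i) (hD i (Finset.mem_univ i))) := by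
      ext v i
      simp [hσ, mulVec_diagonal, Units.smul_def]
    rw [h, FiniteField.sign_diagonal hF, det_diagonal, map_prod, Units.coe_prod]
    exact Finset.prod_congr rfl fun i _ => FiniteField.sign_toPerm_units hF _
  · intro t σ hσ
    have : NeZero (2 : F) := ⟨Ring.two_ne_zero hF⟩
    have hunit : IsUnit (transvection t.i t.j (t.c / 2)).det := by
      simp [det_transvection_of_ne _ _ t.hij]
    obtain ⟨τ, hτ⟩ := exists_perm_mulVec hunit
    have h : σ = τ * τ := by
      ext1 v
      rw [hσ, Perm.mul_apply, hτ, hτ, mulVec_mulVec, transvection_mul_transvection_same _ _ t.hij,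
        add_halves]
      rfl
    rw [h, Perm.sign_mul, Int.units_mul_self, t.det]
    simp
  · intro A B hA hB ihA ihB σ hσ
    obtain ⟨α, hα⟩ := exists_perm_mulVec (isUnit_iff_ne_zero.mpr hA)
    obtain ⟨β, hβ⟩ := exists_perm_mulVec (isUnit_iff_ne_zero.mpr hB)
    have h : σ = α * β := by
      ext1 v
      rw [hσ, Perm.mul_apply, hα, hβ, mulVec_mulVec]
    rw [h, Perm.sign_mul, Units.val_mul, ihA α hα, ihB β hβ, det_mul, map_mul]

end FiniteField

theorem Matrix.det_map_intCast {n R : Type*} [Fintype n] [DecidableEq n] [CommRing R]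
    (A : Matrix n n ℤ) : (A.map (Int.cast : ℤ → R)).det = (A.det : R) :=
  ((Int.castRingHom R).map_det A).symm

theorem ZMod.sign_mulVec_intCast {n : Type*} [Fintype n] [DecidableEq n] (A : Matrix n n ℤ)
    (b : ℕ) [NeZero b] (hb : Odd b) (hA : IsUnit (A.det : ZMod b)) (σ : Perm (n → ZMod b))
    (hσ : ∀ v, σ v = A.map (Int.cast : ℤ → ZMod b) *ᵥ v) :
    ((sign σ : ℤˣ) : ℤ) = jacobiSym A.det b := by
  revert ‹NeZero b›
  induction b using induction_on_primes with
  | zero => intro h; exact absurd rfl h.out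
  | one =>
    intro _
    rw [Subsingleton.elim σ 1]
    simp
  | prime_mul p m hp ih =>
    intro _
    have : Fact p.Prime := ⟨hp⟩
    have : NeZero m := ⟨by rintro rfl; simp at hb⟩
    obtain ⟨hpo, hmo⟩ := Nat.odd_mul.mp hb
    let gp : ZMod (p * m) →+* ZMod p := ZMod.castHom (dvd_mul_right p m) _
    have hAp : IsUnit (A.det : ZMod p) := by simpa using hA.map gp
    have hAm : IsUnit (A.det : ZMod m) := by
      simpa using hA.map (ZMod.castHom (dvd_mul_left m p) (ZMod m))
    obtain ⟨γ, hγ⟩ := exists_perm_mulVec (M := A.map (Int.cast : ℤ → ZMod m))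
      (by rwa [det_map_intCast])
    obtain ⟨κ, hκ⟩ := exists_perm_mulVec (M := A.map (Int.cast : ℤ → ZMod p))
      (by rwa [det_map_intCast])
    obtain ⟨f, hf⟩ : ∃ f : ZMod m →+ ZMod (p * m), ∀ k : ℤ, f k = (p * k : ℤ) :=
      ⟨ZMod.lift m ⟨((Int.castAddHom (ZMod (p * m))).comp (AddMonoidHom.mulLeft (p : ℤ))), by
        have h := ZMod.natCast_self (p * m)
        rw [Nat.cast_mul] at h
        simpa using h⟩, fun k => by simp⟩
    have hf_inj : Function.Injective f := by
      rw [injective_iff_map_eq_zero]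
      intro x hx
      obtain ⟨k, rfl⟩ := ZMod.intCast_surjective x
      rw [hf, ZMod.intCast_zmod_eq_zero_iff_dvd] at hx
      rw [ZMod.intCast_zmod_eq_zero_iff_dvd]
      push_cast at hx
      exact Int.dvd_of_mul_dvd_mul_left (by exact_mod_cast hp.ne_zero) hx
    have hfg (x : ZMod (p * m)) : gp x = 0 ↔ ∃ c, f c = x := by
      constructor
      · obtain ⟨k, rfl⟩ := ZMod.intCast_surjective x
        intro hx
        rw [map_intCast, ZMod.intCast_zmod_eq_zero_iff_dvd] at hx
        obtain ⟨l, rfl⟩ := hx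
        exact ⟨l, hf l⟩
      · rintro ⟨c, rfl⟩
        obtain ⟨k, rfl⟩ := ZMod.intCast_surjective c
        rw [hf, map_intCast]
        simp
    have hsign := sign_eq_mul_of_exact (f.compLeft n) (gp.toAddMonoidHom.compLeft n)
      hf_inj.comp_left (ZMod.castHom_surjective (dvd_mul_right p m)).comp_left
      (fun x => by
        simp only [funext_iff]
        exact (forall_congr' fun i => hfg (x i)).trans Classical.skolem)
      γ σ κ
      (fun x y => by simp only [hσ, mulVec_add])
      (fun c => by
        ext i
        have hfmul (a : ℤ) (x : ZMod m) : f (a * x) = a * f x := by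
          rw [← zsmul_eq_mul, map_zsmul, zsmul_eq_mul]
        simp [hσ, hγ, mulVec, dotProduct, hfmul])
      (fun x => by
        ext i
        simp [hσ, hκ, mulVec, dotProduct])
      (by simpa using hmo.pow) (by simpa using hpo.pow)
    have hchar : ringChar (ZMod p) ≠ 2 := by
      rw [ZMod.ringChar_zmod_n]
      rintro rfl
      exact absurd hpo (by decide)
    rw [hsign, Units.val_mul, ih hmo hAm γ hγ, jacobiSym.mul_right,
      ← jacobiSym.legendreSym.to_jacobiSym p,
      FiniteField.sign_mulVec hchar _ (by rw [det_map_intCast]; exact hAp.ne_zero) κ hκ,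
      det_map_intCast, legendreSym, mul_comm]

/-- Let `b` be a positive odd integer and `B` a free `ℤ/bℤ`-module of finite rank.
For every `ℤ/bℤ`-module automorphism `σ` of `B`, the sign of `σ` as a permutation of
the underlying finite set of `B` equals the Jacobi symbol `(d/b)`, where `d` is any
integer reducing to `det σ` modulo `b`. -/
theorem stmt_19 (b : ℕ) (hb : 0 < b) (hodd : Odd b)
    {B : Type*} [AddCommGroup B] [Module (ZMod b) B]
    [Module.Free (ZMod b) B] [Module.Finite (ZMod b) B]
    [Fintype B] [DecidableEq B]
    (σ : B ≃ₗ[ZMod b] B) (d : ℤ) (hd : (d : ZMod b) = LinearMap.det (σ : B →ₗ[ZMod b] B)) :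
    ((Equiv.Perm.sign σ.toEquiv : ℤˣ) : ℤ) = jacobiSym d b := by
  classical
  have : NeZero b := ⟨hb.ne'⟩
  let e := Module.Free.chooseBasis (ZMod b) B
  let M := LinearMap.toMatrix e e (σ : B →ₗ[ZMod b] B)
  choose r hr using ZMod.intCast_surjective (n := b)
  have hM : (M.map r).map (Int.cast : ℤ → ZMod b) = M := by
    ext i j
    simp [hr]
  have hdet : ((M.map r).det : ZMod b) = d := by
    rw [← Matrix.det_map_intCast, hM, hd, LinearMap.det_toMatrix]
  have hunit : IsUnit ((M.map r).det : ZMod b) := by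
    rw [hdet, hd]
    exact σ.isUnit_det'
  rw [jacobiSym.mod_left' ((ZMod.intCast_eq_intCast_iff' _ _ _).mp hdet.symm),
    ← ZMod.sign_mulVec_intCast (M.map r) b hodd hunit (e.equivFun.toEquiv.permCongr σ.toEquiv),
    sign_permCongr]
  intro v
  rw [hM]
  have h := LinearMap.toMatrix_mulVec_repr e e (σ : B →ₗ[ZMod b] B) (e.equivFun.symm v)
  rw [← e.equivFun_apply, LinearEquiv.apply_symm_apply] at h
  exact h.symm
end
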